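/- arXiv:1909.08885 — 4 statements merged into one kernel-verified Lean document; each statement's English description precedes it below -/
import Mathlib

section
/- Let n ≥ 1, B > -(n-2)²/4, 0 ≤ A < n−1+2ρ with ρ = ((2-n)+√((n-2)²+4B))/2, α = (n+A−1+2ρ)/2, γ = n−1+2ρ, and fix λ > 1, p > (n+ρ)/(n+ρ−1) and β ≠ 0 with β ≤ γ − α − 1/p, with p' = p/(p−1). With Ψ_β and S(T;β₁,β) defined as in the context, there is a constant C (independent of T) such that for all T ≥ 1: S(T;β,β) ≤ C T^{(ρ+n)/p' − β − 2 + β/p} · S₀(T)^{1/p'}, where S₀(T) = T if β < γ−α−1/p and S₀(T) = T ln(T+1) if β = γ−α−1/p. -/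
open MeasureTheory

/-- The hypergeometric function via the Euler integral representation,
`F(α,β,γ;z) = (Γ(γ)/(Γ(α)Γ(γ−α))) ∫₀¹ s^(α−1) (1−s)^(γ−α−1) (1−zs)^(−β) ds`,
valid for `γ > α > 0` and `z < 1`. -/
noncomputable def hyperF (α β γ z : ℝ) : ℝ :=
  (Real.Gamma γ / (Real.Gamma α * Real.Gamma (γ - α))) *
    ∫ s in (0 : ℝ)..1, s ^ (α - 1) * (1 - s) ^ (γ - α - 1) * (1 - z * s) ^ (-β)

/-- The test function `Ψ_β(t,x;λ) = |x|^ρ (t+|x|+λ)^(−β) F(α,β,γ; 2|x|/(t+|x|+λ))`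
on `ℝⁿ`. -/
noncomputable def Psi (n : ℕ) (α γ ρ β lam : ℝ) (t : ℝ)
    (x : EuclideanSpace ℝ (Fin n)) : ℝ :=
  ‖x‖ ^ ρ * (t + ‖x‖ + lam) ^ (-β) * hyperF α β γ (2 * ‖x‖ / (t + ‖x‖ + lam))

/-- The quantity `S(T;β₁,β)` built from the three space-time integrals of the
test functions over `[T/2,T] × B(0,1+t)`. -/
noncomputable def Sfun (n : ℕ) (α γ ρ lam p p' β₁ β T : ℝ) : ℝ :=
  T ^ (-2 : ℝ) *
      (∫ t in (T/2)..T, ∫ x in Metric.ball (0 : EuclideanSpace ℝ (Fin n)) (1 + t),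
          Psi n α γ ρ β₁ lam t x ^ p' * Psi n α γ ρ β lam t x ^ (-(p' / p))) ^ (1 / p')
    + T ^ (-1 : ℝ) *
      (∫ t in (T/2)..T, ∫ x in Metric.ball (0 : EuclideanSpace ℝ (Fin n)) (1 + t),
          ‖x‖ ^ (-p') * Psi n α γ ρ β₁ lam t x ^ p' *
            Psi n α γ ρ β lam t x ^ (-(p' / p))) ^ (1 / p')
    + T ^ (-1 : ℝ) *
      (∫ t in (T/2)..T, ∫ x in Metric.ball (0 : EuclideanSpace ℝ (Fin n)) (1 + t),
          |deriv (fun t' => Psi n α γ ρ β₁ lam t' x) t| ^ p' *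
            Psi n α γ ρ β lam t x ^ (-(p' / p))) ^ (1 / p')

/-- The real Euler beta kernel is integrable on `[0, 1]`. -/
lemma intervalIntegrable_betaKernel {a c : ℝ} (ha : 0 < a) (hc : 0 < c) :
    IntervalIntegrable (fun s : ℝ => s ^ (a - 1) * (1 - s) ^ (c - 1)) volume 0 1 := by
  have h := (Complex.betaIntegral_convergent (u := (a : ℂ)) (v := (c : ℂ))
    (by simpa using ha) (by simpa using hc)).norm
  refine h.congr_uIoo fun s hs => ?_
  rw [Set.uIoo_of_le zero_le_one] at hs
  have h1 : (1 : ℂ) - (s : ℂ) = ((1 - s : ℝ) : ℂ) := by push_cast; rfl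
  simp only [norm_mul, h1]
  rw [Complex.norm_cpow_eq_rpow_re_of_pos hs.1,
    Complex.norm_cpow_eq_rpow_re_of_pos (by linarith [hs.2])]
  simp

lemma one_sub_mul_pos {z s : ℝ} (hz0 : 0 ≤ z) (hz1 : z < 1) (hs : s ≤ 1) : 0 < 1 - z * s := by
  nlinarith

lemma intervalIntegrable_hyperKernel {a c b z : ℝ} (ha : 0 < a) (hc : 0 < c)
    (hz0 : 0 ≤ z) (hz1 : z < 1) :
    IntervalIntegrable (fun s : ℝ => s ^ (a - 1) * (1 - s) ^ (c - 1) * (1 - z * s) ^ (-b))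
      volume 0 1 := by
  refine (intervalIntegrable_betaKernel ha hc).mul_continuousOn ?_
  rw [Set.uIcc_of_le zero_le_one]
  refine ContinuousOn.rpow_const (by fun_prop) fun s hs => Or.inl ?_
  exact (one_sub_mul_pos hz0 hz1 hs.2).ne'

lemma hyperF_const_pos {α γ : ℝ} (hα : 0 < α) (hc : 0 < γ - α) :
    0 < Real.Gamma γ / (Real.Gamma α * Real.Gamma (γ - α)) :=
  div_pos (Real.Gamma_pos_of_pos (by linarith))
    (mul_pos (Real.Gamma_pos_of_pos hα) (Real.Gamma_pos_of_pos hc))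

/-- On `[0, 1)` the hypergeometric function is bounded below by a positive constant. -/
lemma exists_le_hyperF {α γ : ℝ} (b : ℝ) (hα : 0 < α) (hc : 0 < γ - α) :
    ∃ k : ℝ, 0 < k ∧ ∀ z : ℝ, 0 ≤ z → z < 1 → k ≤ hyperF α b γ z := by
  have hG := hyperF_const_pos hα hc
  have hc' : 0 < γ - α + |b| := by positivity
  have hI := intervalIntegrable_betaKernel hα hc'
  refine ⟨_, mul_pos hG (intervalIntegral.intervalIntegral_pos_of_pos_on hI
    (fun s hs => mul_pos (Real.rpow_pos_of_pos hs.1 _)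
      (Real.rpow_pos_of_pos (by linarith [hs.2]) _)) one_pos), fun z hz0 hz1 => ?_⟩
  refine mul_le_mul_of_nonneg_left ?_ hG.le
  refine intervalIntegral.integral_mono_on_of_le_Ioo zero_le_one hI
    (intervalIntegrable_hyperKernel hα hc hz0 hz1) fun s hs => ?_
  have h1s : 0 < 1 - s := by linarith [hs.2]
  have hle : 1 - s ≤ 1 - z * s := by nlinarith [hs.1]
  have hle1 : 1 - z * s ≤ 1 := by nlinarith [hs.1]
  have hpos := one_sub_mul_pos hz0 hz1 hs.2.le
  have : (1 - s) ^ (γ - α + |b| - 1) = (1 - s) ^ (γ - α - 1) * (1 - s) ^ |b| := by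
    rw [← Real.rpow_add h1s]; ring_nf
  rw [this, ← mul_assoc]
  have h0 : 0 ≤ s ^ (α - 1) * (1 - s) ^ (γ - α - 1) :=
    mul_nonneg (Real.rpow_nonneg hs.1.le _) (Real.rpow_nonneg h1s.le _)
  refine mul_le_mul_of_nonneg_left ?_ h0
  calc (1 - s) ^ |b| ≤ (1 - z * s) ^ |b| := Real.rpow_le_rpow h1s.le hle (abs_nonneg b)
    _ ≤ (1 - z * s) ^ (-b) := Real.rpow_le_rpow_of_exponent_ge hpos hle1 (neg_le_abs b)

/-- In the regime `b < γ - α` the hypergeometric function is bounded on `[0, 1)`. -/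
lemma exists_hyperF_le {α γ b : ℝ} (hα : 0 < α) (hc : 0 < γ - α) (hb : b < γ - α) :
    ∃ K : ℝ, 0 < K ∧ ∀ z : ℝ, 0 ≤ z → z < 1 → hyperF α b γ z ≤ K := by
  have hG := hyperF_const_pos hα hc
  have hc' : 0 < γ - α - max b 0 := by
    rw [sub_pos]; exact max_lt hb hc
  have hI := intervalIntegrable_betaKernel hα hc'
  refine ⟨_, mul_pos hG (intervalIntegral.intervalIntegral_pos_of_pos_on hI
    (fun s hs => mul_pos (Real.rpow_pos_of_pos hs.1 _)
      (Real.rpow_pos_of_pos (by linarith [hs.2]) _)) one_pos), fun z hz0 hz1 => ?_⟩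
  refine mul_le_mul_of_nonneg_left ?_ hG.le
  refine intervalIntegral.integral_mono_on_of_le_Ioo zero_le_one
    (intervalIntegrable_hyperKernel hα hc hz0 hz1) hI fun s hs => ?_
  have h1s : 0 < 1 - s := by linarith [hs.2]
  have hle : 1 - s ≤ 1 - z * s := by nlinarith [hs.1]
  have hle1 : 1 - z * s ≤ 1 := by nlinarith [hs.1]
  have hpos := one_sub_mul_pos hz0 hz1 hs.2.le
  have : (1 - s) ^ (γ - α - max b 0 - 1) = (1 - s) ^ (γ - α - 1) * (1 - s) ^ (-max b 0) := by
    rw [← Real.rpow_add h1s]; ring_nf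
  rw [this, ← mul_assoc]
  have h0 : 0 ≤ s ^ (α - 1) * (1 - s) ^ (γ - α - 1) :=
    mul_nonneg (Real.rpow_nonneg hs.1.le _) (Real.rpow_nonneg h1s.le _)
  refine mul_le_mul_of_nonneg_left ?_ h0
  calc (1 - z * s) ^ (-b) ≤ (1 - z * s) ^ (-max b 0) :=
        Real.rpow_le_rpow_of_exponent_ge hpos hle1 (neg_le_neg (le_max_left _ _))
    _ ≤ (1 - s) ^ (-max b 0) := Real.rpow_le_rpow_of_nonpos h1s hle (by simp)

lemma intervalIntegrable_rpow_mul_max {c e w x y : ℝ} (hc : 0 < c) (hw : 0 < w) :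
    IntervalIntegrable (fun u : ℝ => u ^ (c - 1) * (max u w) ^ e) volume x y := by
  refine (intervalIntegral.intervalIntegrable_rpow' (by linarith)).mul_continuousOn ?_
  exact ContinuousOn.rpow_const (by fun_prop) fun u _ => Or.inl (lt_max_of_lt_right hw).ne'

lemma integral_rpow_mul_max_le {c δ w : ℝ} (hc : 0 < c) (hδ : 0 < δ) (hw : 0 < w) (hw1 : w ≤ 1) :
    ∫ u in (0 : ℝ)..1, u ^ (c - 1) * (max u w) ^ (-(c + δ)) ≤ (1 / c + 1 / δ) * w ^ (-δ) := by
  rw [← intervalIntegral.integral_add_adjacent_intervals (b := w)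
    (intervalIntegrable_rpow_mul_max hc hw) (intervalIntegrable_rpow_mul_max hc hw), add_mul]
  refine add_le_add (le_of_eq ?_) ?_
  · have : ∫ u in (0 : ℝ)..w, u ^ (c - 1) * (max u w) ^ (-(c + δ))
        = ∫ u in (0 : ℝ)..w, u ^ (c - 1) * w ^ (-(c + δ)) := by
      refine intervalIntegral.integral_congr fun u hu => ?_
      rw [Set.uIcc_of_le hw.le] at hu
      simp only [max_eq_right hu.2]
    rw [this, intervalIntegral.integral_mul_const, integral_rpow (Or.inl (by linarith)),
      sub_add_cancel, Real.zero_rpow hc.ne', sub_zero, div_mul_eq_mul_div, ← Real.rpow_add hw]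
    ring_nf
  · have : ∫ u in w..1, u ^ (c - 1) * (max u w) ^ (-(c + δ))
        = ∫ u in w..1, u ^ (-1 - δ) := by
      refine intervalIntegral.integral_congr fun u hu => ?_
      rw [Set.uIcc_of_le hw1] at hu
      have hu0 : 0 < u := hw.trans_le hu.1
      simp only [max_eq_left hu.1]
      rw [← Real.rpow_add hu0]
      ring_nf
    rw [this, integral_rpow (Or.inr ⟨by linarith, by
      rw [Set.uIcc_of_le hw1]; exact fun h => absurd h.1 (not_le.mpr hw)⟩)]
    have h1 : -1 - δ + 1 = -δ := by ring
    rw [h1, Real.one_rpow, div_neg, ← neg_div, div_mul_eq_mul_div]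
    gcongr
    linarith

/-- The hypergeometric function has at most a power singularity at `z = 1`. -/
lemma exists_hyperF_le_rpow {α γ b δ : ℝ} (hα : 0 < α) (hc : 0 < γ - α) (hδ : 0 < δ)
    (hb : b ≤ γ - α + δ) :
    ∃ K : ℝ, 0 < K ∧ ∀ z : ℝ, 0 ≤ z → z < 1 → hyperF α b γ z ≤ K * (1 - z) ^ (-δ) := by
  have hG := hyperF_const_pos hα hc
  set G := Real.Gamma γ / (Real.Gamma α * Real.Gamma (γ - α)) with hGdef
  set c := γ - α with hcdef
  have hI := intervalIntegrable_betaKernel hα hc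
  set J := ∫ s in (0 : ℝ)..1, s ^ (α - 1) * (1 - s) ^ (c - 1) with hJ
  have hJ0 : 0 ≤ J := intervalIntegral.integral_nonneg zero_le_one fun s hs =>
    mul_nonneg (Real.rpow_nonneg hs.1 _) (Real.rpow_nonneg (by linarith [hs.2]) _)
  set D : ℝ := 2 ^ |α - 1| with hD
  set E : ℝ := 2 ^ (c + δ) with hE
  refine ⟨G * (E * J + D * (1 / c + 1 / δ)), by positivity, fun z hz0 hz1 => ?_⟩
  have hw : 0 < 1 - z := by linarith
  set w := 1 - z with hwdef
  have hmono : ∀ s ∈ Set.Ioo (0 : ℝ) 1,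
      s ^ (α - 1) * (1 - s) ^ (c - 1) * (1 - z * s) ^ (-b) ≤
        E * (s ^ (α - 1) * (1 - s) ^ (c - 1)) +
          D * ((1 - s) ^ (c - 1) * (max (1 - s) w) ^ (-(c + δ))) := by
    intro s hs
    have h1s : 0 < 1 - s := by linarith [hs.2]
    have hle : 1 - s ≤ 1 - z * s := by nlinarith [hs.1]
    have hle1 : 1 - z * s ≤ 1 := by nlinarith [hs.1]
    have hlew : w ≤ 1 - z * s := by rw [hwdef]; nlinarith [hs.2]
    have hpos := one_sub_mul_pos hz0 hz1 hs.2.le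
    have hp1 : 0 ≤ s ^ (α - 1) := Real.rpow_nonneg hs.1.le _
    have hp2 : 0 ≤ (1 - s) ^ (c - 1) := Real.rpow_nonneg h1s.le _
    have hp3 : 0 ≤ (max (1 - s) w) ^ (-(c + δ)) := Real.rpow_nonneg (le_max_of_le_left h1s.le) _
    have hb' : (1 - z * s) ^ (-b) ≤ (1 - z * s) ^ (-(c + δ)) :=
      Real.rpow_le_rpow_of_exponent_ge hpos hle1 (by linarith)
    have hmx : (1 - z * s) ^ (-(c + δ)) ≤ (max (1 - s) w) ^ (-(c + δ)) :=
      Real.rpow_le_rpow_of_nonpos (lt_max_of_lt_left h1s) (max_le hle hlew) (by linarith)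
    rcases le_total s (1 / 2) with hs2 | hs2
    · have h2 : (1 - z * s) ^ (-b) ≤ E := by
        refine hb'.trans ?_
        have : (1 - z * s) ^ (-(c + δ)) ≤ (1 / 2 : ℝ) ^ (-(c + δ)) :=
          Real.rpow_le_rpow_of_nonpos (by norm_num) (by linarith) (by linarith)
        rwa [one_div, Real.inv_rpow (by norm_num), ← Real.rpow_neg (by norm_num), neg_neg] at this
      have h3 : 0 ≤ D * ((1 - s) ^ (c - 1) * (max (1 - s) w) ^ (-(c + δ))) := by positivity
      have h4 := mul_le_mul_of_nonneg_left h2 (mul_nonneg hp1 hp2)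
      linarith
    · have h2 : s ^ (α - 1) ≤ D := by
        calc s ^ (α - 1) ≤ s ^ (-|α - 1|) :=
              Real.rpow_le_rpow_of_exponent_ge hs.1 hs.2.le (neg_abs_le _)
          _ ≤ (1 / 2 : ℝ) ^ (-|α - 1|) :=
              Real.rpow_le_rpow_of_nonpos (by norm_num) hs2 (by simp)
          _ = D := by
              rw [one_div, Real.inv_rpow (by norm_num), ← Real.rpow_neg (by norm_num), neg_neg]
      have h3 : 0 ≤ E * (s ^ (α - 1) * (1 - s) ^ (c - 1)) := by positivity
      have h4 : s ^ (α - 1) * (1 - s) ^ (c - 1) * (1 - z * s) ^ (-b) ≤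
          D * (1 - s) ^ (c - 1) * (max (1 - s) w) ^ (-(c + δ)) :=
        mul_le_mul (mul_le_mul_of_nonneg_right h2 hp2) (hb'.trans hmx)
          (Real.rpow_nonneg hpos.le _) (by positivity)
      linarith
  have hmaxI : IntervalIntegrable
      (fun s : ℝ => (1 - s) ^ (c - 1) * (max (1 - s) w) ^ (-(c + δ))) volume 0 1 := by
    simpa using ((intervalIntegrable_rpow_mul_max (x := 0) (y := 1)
      (e := -(c + δ)) hc hw).comp_sub_left 1).symm
  have hmaxE : ∫ s in (0 : ℝ)..1, (1 - s) ^ (c - 1) * (max (1 - s) w) ^ (-(c + δ))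
      = ∫ u in (0 : ℝ)..1, u ^ (c - 1) * (max u w) ^ (-(c + δ)) := by
    simpa using intervalIntegral.integral_comp_sub_left (a := 0) (b := 1)
      (fun u : ℝ => u ^ (c - 1) * (max u w) ^ (-(c + δ))) 1
  have key := intervalIntegral.integral_mono_on_of_le_Ioo zero_le_one
    (intervalIntegrable_hyperKernel hα hc hz0 hz1) ((hI.const_mul E).add (hmaxI.const_mul D)) hmono
  rw [intervalIntegral.integral_add (hI.const_mul E) (hmaxI.const_mul D),
    intervalIntegral.integral_const_mul, intervalIntegral.integral_const_mul, hmaxE, ← hJ] at key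
  have hmx := integral_rpow_mul_max_le hc hδ hw (by linarith : w ≤ 1)
  have hw1 : 1 ≤ w ^ (-δ) :=
    Real.one_le_rpow_of_pos_of_le_one_of_nonpos hw (by linarith) (by linarith)
  have hD0 : 0 ≤ D := by positivity
  have hEJ : 0 ≤ E * J := by positivity
  have hfin : ∫ s in (0 : ℝ)..1, s ^ (α - 1) * (1 - s) ^ (c - 1) * (1 - z * s) ^ (-b)
      ≤ (E * J + D * (1 / c + 1 / δ)) * w ^ (-δ) := by
    have h1 := mul_le_mul_of_nonneg_left hmx hD0
    have h2 := mul_le_mul_of_nonneg_left hw1 hEJ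
    linarith
  have := mul_le_mul_of_nonneg_left hfin hG.le
  rw [← mul_assoc] at this
  exact this

lemma hyper_arg_nonneg {t r lam : ℝ} (hr : 0 ≤ r) (h : r < t + lam) :
    0 ≤ 2 * r / (t + r + lam) := div_nonneg (by linarith) (by linarith)

lemma one_sub_hyper_arg {t r lam : ℝ} (hr : 0 ≤ r) (h : r < t + lam) :
    1 - 2 * r / (t + r + lam) = (t + lam - r) / (t + r + lam) := by
  have : t + r + lam ≠ 0 := by linarith
  field_simp
  ring

lemma hyper_arg_lt_one {t r lam : ℝ} (hr : 0 ≤ r) (h : r < t + lam) :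
    2 * r / (t + r + lam) < 1 := by
  have := one_sub_hyper_arg hr h
  have h2 : 0 < (t + lam - r) / (t + r + lam) := div_pos (by linarith) (by linarith)
  linarith

lemma light_cone_le {t r lam s : ℝ} (hr : 0 ≤ r) (hs : s ≤ 1) :
    t + lam - r ≤ t + r + lam - 2 * r * s := by
  nlinarith

/-- Absorbing the power of `t + |x| + λ` into the Euler integral. -/
lemma Psi_eq_integral (n : ℕ) (α γ ρ b lam t : ℝ) (x : EuclideanSpace ℝ (Fin n))
    (h : ‖x‖ < t + lam) :
    Psi n α γ ρ b lam t x = ‖x‖ ^ ρ * (Real.Gamma γ / (Real.Gamma α * Real.Gamma (γ - α)) *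
      ∫ s in (0 : ℝ)..1, s ^ (α - 1) * (1 - s) ^ (γ - α - 1) *
        (t + ‖x‖ + lam - 2 * ‖x‖ * s) ^ (-b)) := by
  have hr := norm_nonneg x
  have hτ : 0 < t + ‖x‖ + lam := by linarith
  have : ∫ s in (0 : ℝ)..1, s ^ (α - 1) * (1 - s) ^ (γ - α - 1) *
        (t + ‖x‖ + lam - 2 * ‖x‖ * s) ^ (-b) = (t + ‖x‖ + lam) ^ (-b) *
      ∫ s in (0 : ℝ)..1, s ^ (α - 1) * (1 - s) ^ (γ - α - 1) *
        (1 - 2 * ‖x‖ / (t + ‖x‖ + lam) * s) ^ (-b) := by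
    rw [← intervalIntegral.integral_const_mul]
    refine intervalIntegral.integral_congr fun s hs => ?_
    rw [Set.uIcc_of_le zero_le_one] at hs
    have h1 := one_sub_mul_pos (hyper_arg_nonneg hr h) (hyper_arg_lt_one hr h) hs.2
    have h2 : t + ‖x‖ + lam - 2 * ‖x‖ * s =
        (t + ‖x‖ + lam) * (1 - 2 * ‖x‖ / (t + ‖x‖ + lam) * s) := by
      field_simp
    rw [h2, Real.mul_rpow hτ.le h1.le]
    ring
  rw [this, Psi, hyperF]
  ring

lemma rpow_le_rpow_add_rpow {a y M : ℝ} (ha : 0 < a) (hay : a ≤ y) (hyM : y ≤ M) (e : ℝ) :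
    y ^ e ≤ a ^ e + M ^ e := by
  have hy : 0 < y := ha.trans_le hay
  rcases le_total 0 e with he | he
  · have h1 := Real.rpow_le_rpow hy.le hyM he
    have h2 := Real.rpow_nonneg ha.le e
    linarith
  · have h1 := Real.rpow_le_rpow_of_nonpos ha hay he
    have h2 := Real.rpow_nonneg (hy.le.trans hyM) e
    linarith

/-- The time derivative of a test function is again a test function, with `β` raised by one. -/
lemma hasDerivAt_Psi (n : ℕ) {α γ : ℝ} (ρ b lam t : ℝ) (x : EuclideanSpace ℝ (Fin n))
    (hα : 0 < α) (hc : 0 < γ - α) (h : ‖x‖ < t + lam) :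
    HasDerivAt (fun t' => Psi n α γ ρ b lam t' x) (-b * Psi n α γ ρ (b + 1) lam t x) t := by
  have hr := norm_nonneg x
  set r := ‖x‖ with hrdef
  have hε : 0 < (t + lam - r) / 2 := by linarith
  set ε := (t + lam - r) / 2 with hεdef
  have hball : ∀ t' ∈ Metric.ball t ε, ε ≤ t' + lam - r ∧ t' ≤ t + ε := by
    intro t' ht'
    rw [Metric.mem_ball, Real.dist_eq, abs_lt] at ht'
    constructor <;> linarith [ht'.1, ht'.2]
  have hpos : ∀ t' ∈ Metric.ball t ε, ∀ s : ℝ, s ≤ 1 → ε ≤ t' + r + lam - 2 * r * s := by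
    intro t' ht' s hs
    have := (hball t' ht').1
    exact this.trans (light_cone_le hr hs)
  set w : ℝ → ℝ := fun s => s ^ (α - 1) * (1 - s) ^ (γ - α - 1) with hw
  have hwI : IntervalIntegrable w volume 0 1 := intervalIntegrable_betaKernel hα hc
  have hint : ∀ e : ℝ, ∀ t' ∈ Metric.ball t ε, IntervalIntegrable
      (fun s => w s * (t' + r + lam - 2 * r * s) ^ e) volume 0 1 := by
    intro e t' ht'
    refine hwI.mul_continuousOn ?_
    rw [Set.uIcc_of_le zero_le_one]
    exact ContinuousOn.rpow_const (by fun_prop)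
      fun s hs => Or.inl (hε.trans_le (hpos t' ht' s hs.2)).ne'
  have htb : t ∈ Metric.ball t ε := Metric.mem_ball_self hε
  have hnhds : Metric.ball t ε ∈ nhds t := Metric.ball_mem_nhds t hε
  have hder := (intervalIntegral.hasDerivAt_integral_of_dominated_loc_of_deriv_le
    (μ := volume) (a := 0) (b := 1) (𝕜 := ℝ) (x₀ := t) (s := Metric.ball t ε)
    (F := fun t' s => w s * (t' + r + lam - 2 * r * s) ^ (-b))
    (F' := fun t' s => w s * ((-b) * (t' + r + lam - 2 * r * s) ^ (-b - 1)))
    (bound := fun s => w s *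
      (|b| * (ε ^ (-b - 1) + (t + ε + r + lam) ^ (-b - 1)))) hnhds ?_ (hint _ t htb) ?_ ?_
    (hwI.mul_const _) ?_).2
  · have hev : (fun t' => Psi n α γ ρ b lam t' x) =ᶠ[nhds t] fun t' =>
        r ^ ρ * (Real.Gamma γ / (Real.Gamma α * Real.Gamma (γ - α)) *
          ∫ s in (0 : ℝ)..1, w s * (t' + r + lam - 2 * r * s) ^ (-b)) := by
      filter_upwards [hnhds] with t' ht'
      exact Psi_eq_integral n α γ ρ b lam t' x (by linarith [(hball t' ht').1])
    refine (((hder.const_mul _).const_mul _).congr_of_eventuallyEq hev).congr_deriv ?_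
    rw [Psi_eq_integral n α γ ρ (b + 1) lam t x h]
    have : ∫ s in (0 : ℝ)..1, w s * ((-b) * (t + r + lam - 2 * r * s) ^ (-b - 1))
        = (-b) * ∫ s in (0 : ℝ)..1, s ^ (α - 1) * (1 - s) ^ (γ - α - 1) *
          (t + r + lam - 2 * r * s) ^ (-(b + 1)) := by
      rw [← intervalIntegral.integral_const_mul]
      refine intervalIntegral.integral_congr fun s _ => ?_
      simp only [hw]
      rw [show -(b + 1) = -b - 1 by ring]
      ring
    rw [this]
    ring
  · filter_upwards [hnhds] with t' ht'
    have := (hint (-b) t' ht').aestronglyMeasurable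
    rwa [Set.uIoc_of_le zero_le_one]
  · have := ((hint (-b - 1) t htb).const_mul (-b)).aestronglyMeasurable
    rw [Set.uIoc_of_le zero_le_one]
    refine this.congr (Filter.Eventually.of_forall fun s => ?_)
    ring
  · refine Filter.Eventually.of_forall fun s hs t' ht' => ?_
    rw [Set.uIoc_of_le zero_le_one] at hs
    have hw0 : 0 ≤ w s := mul_nonneg (Real.rpow_nonneg hs.1.le _)
      (Real.rpow_nonneg (by linarith [hs.2]) _)
    have hl := hpos t' ht' s hs.2
    have hu : t' + r + lam - 2 * r * s ≤ t + ε + r + lam := by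
      have := (hball t' ht').2
      nlinarith [hs.1]
    have h0 : 0 ≤ (t' + r + lam - 2 * r * s) ^ (-b - 1) := Real.rpow_nonneg (hε.le.trans hl) _
    rw [Real.norm_eq_abs, abs_mul, abs_of_nonneg hw0, abs_mul, abs_neg, abs_of_nonneg h0]
    gcongr
    exact rpow_le_rpow_add_rpow hε hl hu _
  · refine Filter.Eventually.of_forall fun s hs t' ht' => ?_
    rw [Set.uIoc_of_le zero_le_one] at hs
    have hl := hpos t' ht' s hs.2
    have h1 : HasDerivAt (fun y : ℝ => y + r + lam - 2 * r * s) 1 t' :=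
      (((hasDerivAt_id t').add_const r).add_const lam).sub_const _
    have h2 := h1.rpow_const (p := -b) (Or.inl (hε.trans_le hl).ne')
    refine (h2.const_mul (w s)).congr_deriv ?_
    ring

/-- Polar coordinates: comparison of an integral over a ball with a radial majorant. -/
lemma setIntegral_ball_le_radial {n : ℕ} (hn : 1 ≤ n) {R : ℝ} (hR : 0 ≤ R)
    {f : EuclideanSpace ℝ (Fin n) → ℝ} {g : ℝ → ℝ}
    (hf : ∀ x, 0 < ‖x‖ → ‖x‖ < R → 0 ≤ f x ∧ f x ≤ g ‖x‖)
    (hg : IntervalIntegrable (fun y : ℝ => y ^ ((n : ℝ) - 1) * g y) volume 0 R) :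
    0 ≤ ∫ x in Metric.ball (0 : EuclideanSpace ℝ (Fin n)) R, f x ∧
    ∫ x in Metric.ball (0 : EuclideanSpace ℝ (Fin n)) R, f x ≤
      n * volume.real (Metric.ball (0 : EuclideanSpace ℝ (Fin n)) 1) *
        ∫ y in (0 : ℝ)..R, y ^ ((n : ℝ) - 1) * g y := by
  have : Nonempty (Fin n) := ⟨⟨0, hn⟩⟩
  have hpow : ∀ y : ℝ, y ^ (n - 1) = y ^ ((n : ℝ) - 1) := fun y => by
    rw [← Real.rpow_natCast, Nat.cast_sub hn, Nat.cast_one]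
  have hae : ∀ᵐ x ∂(volume.restrict (Metric.ball (0 : EuclideanSpace ℝ (Fin n)) R)),
      0 < ‖x‖ ∧ ‖x‖ < R := by
    have h0 : ∀ᵐ x ∂(volume.restrict (Metric.ball (0 : EuclideanSpace ℝ (Fin n)) R)), x ≠ 0 :=
      ae_restrict_of_ae (by simp [ae_iff])
    filter_upwards [h0, ae_restrict_mem measurableSet_ball] with x hx hxR
    exact ⟨norm_pos_iff.mpr hx, by simpa using hxR⟩
  have hnn : 0 ≤ᵐ[volume.restrict (Metric.ball (0 : EuclideanSpace ℝ (Fin n)) R)] f := by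
    filter_upwards [hae] with x hx
    exact (hf x hx.1 hx.2).1
  refine ⟨integral_nonneg_of_ae hnn, ?_⟩
  rw [intervalIntegrable_iff_integrableOn_Ioo_of_le hR] at hg
  have hgi : IntegrableOn (fun x : EuclideanSpace ℝ (Fin n) => g ‖x‖) (Metric.ball 0 R) := by
    rw [integrableOn_fun_norm_addHaar volume, finrank_euclideanSpace_fin]
    simpa only [smul_eq_mul, hpow] using hg
  refine (integral_mono_of_nonneg hnn hgi ?_).trans (le_of_eq ?_)
  · filter_upwards [hae] with x hx
    exact (hf x hx.1 hx.2).2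
  · have h1 : ∫ x in Metric.ball (0 : EuclideanSpace ℝ (Fin n)) R, g ‖x‖ =
        ∫ x : EuclideanSpace ℝ (Fin n), (Set.Iio R).indicator g ‖x‖ := by
      rw [← integral_indicator measurableSet_ball]
      refine integral_congr_ae (Filter.Eventually.of_forall fun x => ?_)
      simp [Set.indicator]
    have h2 : ∫ y in Set.Ioi (0 : ℝ), y ^ (n - 1) • (Set.Iio R).indicator g y =
        ∫ y in Set.Ioo (0 : ℝ) R, y ^ ((n : ℝ) - 1) * g y := by
      rw [← Set.Ioi_inter_Iio, ← setIntegral_indicator measurableSet_Iio]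
      refine integral_congr_ae (Filter.Eventually.of_forall fun y => ?_)
      by_cases hy : y ∈ Set.Iio R <;> simp [hy, hpow]
    rw [h1, integral_fun_norm_addHaar volume, finrank_euclideanSpace_fin, h2,
      intervalIntegral.integral_of_le hR, integral_Ioc_eq_integral_Ioo]
    simp [mul_assoc]

/-- Space-time version of `setIntegral_ball_le_radial`. -/
lemma spacetime_integral_le {n : ℕ} (hn : 1 ≤ n) {T Q : ℝ} (hT : 1 ≤ T)
    {f : ℝ → EuclideanSpace ℝ (Fin n) → ℝ} {g : ℝ → ℝ → ℝ}
    (hf : ∀ t, T / 2 ≤ t → t ≤ T → ∀ x, 0 < ‖x‖ → ‖x‖ < 1 + t → 0 ≤ f t x ∧ f t x ≤ g t ‖x‖)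
    (hg : ∀ t, T / 2 ≤ t → t ≤ T →
      IntervalIntegrable (fun y : ℝ => y ^ ((n : ℝ) - 1) * g t y) volume 0 (1 + t))
    (hQ : ∀ t, T / 2 ≤ t → t ≤ T → ∫ y in (0 : ℝ)..(1 + t), y ^ ((n : ℝ) - 1) * g t y ≤ Q) :
    0 ≤ ∫ t in (T / 2)..T, ∫ x in Metric.ball (0 : EuclideanSpace ℝ (Fin n)) (1 + t), f t x ∧
    ∫ t in (T / 2)..T, ∫ x in Metric.ball (0 : EuclideanSpace ℝ (Fin n)) (1 + t), f t x ≤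
      n * volume.real (Metric.ball (0 : EuclideanSpace ℝ (Fin n)) 1) * Q * T := by
  have hT2 : T / 2 ≤ T := by linarith
  set V := volume.real (Metric.ball (0 : EuclideanSpace ℝ (Fin n)) 1) with hV
  have hV0 : 0 ≤ (n : ℝ) * V := by positivity
  have hin : ∀ t, T / 2 ≤ t → t ≤ T →
      0 ≤ ∫ x in Metric.ball (0 : EuclideanSpace ℝ (Fin n)) (1 + t), f t x ∧
      ∫ x in Metric.ball (0 : EuclideanSpace ℝ (Fin n)) (1 + t), f t x ≤ n * V * Q := by
    intro t h1 h2
    have := setIntegral_ball_le_radial hn (by linarith) (hf t h1 h2) (hg t h1 h2)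
    exact ⟨this.1, this.2.trans (mul_le_mul_of_nonneg_left (hQ t h1 h2) hV0)⟩
  have hVQ : 0 ≤ n * V * Q := (hin T hT2 le_rfl).1.trans (hin T hT2 le_rfl).2
  refine ⟨intervalIntegral.integral_nonneg hT2 fun t ht => (hin t ht.1 ht.2).1, ?_⟩
  have := intervalIntegral.norm_integral_le_of_norm_le_const (a := T / 2) (b := T)
    (f := fun t => ∫ x in Metric.ball (0 : EuclideanSpace ℝ (Fin n)) (1 + t), f t x)
    (C := n * V * Q) fun t ht => by
      rw [Set.uIoc_of_le hT2] at ht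
      have := hin t ht.1.le ht.2
      rw [Real.norm_eq_abs, abs_of_nonneg this.1]
      exact this.2
  refine (le_abs_self _).trans (this.trans (mul_le_mul_of_nonneg_left ?_ hVQ))
  rw [abs_of_nonneg (by linarith)]
  linarith

lemma rpow_le_of_comparable {M T τ : ℝ} (hM : 1 ≤ M) (hT : 0 < T) (h1 : T / M ≤ τ)
    (h2 : τ ≤ M * T) (e : ℝ) : τ ^ e ≤ M ^ |e| * T ^ e := by
  have hM0 : 0 < M := by linarith
  have hTM : 0 < T / M := div_pos hT hM0
  rcases le_total 0 e with he | he
  · rw [abs_of_nonneg he, ← Real.mul_rpow hM0.le hT.le]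
    exact Real.rpow_le_rpow (hTM.le.trans h1) h2 he
  · rw [abs_of_nonpos he]
    refine (Real.rpow_le_rpow_of_nonpos hTM h1 he).trans (le_of_eq ?_)
    rw [Real.div_rpow hT.le hM0.le, Real.rpow_neg hM0.le]
    ring

lemma integral_radial_power_le {n : ℕ} {e K M R T : ℝ} (he : 0 < (n : ℝ) + e) (hK : 0 ≤ K)
    (hR : 0 ≤ R) (hM : 0 ≤ M) (hT : 0 ≤ T) (hRT : R ≤ M * T) :
    IntervalIntegrable (fun y : ℝ => y ^ ((n : ℝ) - 1) * (K * y ^ e)) volume 0 R ∧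
    ∫ y in (0 : ℝ)..R, y ^ ((n : ℝ) - 1) * (K * y ^ e) ≤
      K * (M ^ (n + e) / (n + e)) * T ^ (n + e) := by
  have heq : Set.EqOn (fun y : ℝ => y ^ ((n : ℝ) - 1) * (K * y ^ e))
      (fun y : ℝ => K * y ^ ((n : ℝ) + e - 1)) (Set.uIoc 0 R) := by
    intro y hy
    rw [Set.uIoc_of_le hR] at hy
    simp only
    rw [show (n : ℝ) + e - 1 = (n - 1) + e by ring, Real.rpow_add hy.1]
    ring
  have hI : IntervalIntegrable (fun y : ℝ => K * y ^ ((n : ℝ) + e - 1)) volume 0 R :=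
    (intervalIntegral.intervalIntegrable_rpow' (by linarith)).const_mul K
  refine ⟨hI.congr heq.symm, ?_⟩
  have h2 : ∫ y in (0 : ℝ)..R, y ^ ((n : ℝ) - 1) * (K * y ^ e) =
      ∫ y in (0 : ℝ)..R, K * y ^ ((n : ℝ) + e - 1) :=
    intervalIntegral.integral_congr_ae (Filter.Eventually.of_forall fun y hy => heq hy)
  rw [h2, intervalIntegral.integral_const_mul, integral_rpow (Or.inl (by linarith)),
    sub_add_cancel, Real.zero_rpow he.ne', sub_zero, mul_assoc]
  refine mul_le_mul_of_nonneg_left ?_ hK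
  rw [div_mul_eq_mul_div, ← Real.mul_rpow hM hT]
  gcongr

lemma intervalIntegrable_cone {κ lam t : ℝ} (hlam : 1 < lam) (ht : 0 ≤ t) :
    IntervalIntegrable (fun y : ℝ => (t + lam - y) ^ (-κ)) volume 0 (1 + t) := by
  refine ContinuousOn.intervalIntegrable ?_
  rw [Set.uIcc_of_le (by linarith)]
  exact ContinuousOn.rpow_const (by fun_prop) fun y hy => Or.inl (by linarith [hy.2])

/-- The weight of the light cone, integrated against a radial power. -/
lemma integral_radial_cone_le {n : ℕ} {e K M T t lam κ L : ℝ} (he : 0 ≤ (n : ℝ) - 1 + e)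
    (hK : 0 ≤ K) (hM : 0 ≤ M) (hT : 0 ≤ T) (ht : 0 ≤ t) (hlam : 1 < lam)
    (hRT : 1 + t ≤ M * T)
    (hL : ∫ y in (0 : ℝ)..(1 + t), (t + lam - y) ^ (-κ) ≤ L) :
    IntervalIntegrable (fun y : ℝ => y ^ ((n : ℝ) - 1) * (K * y ^ e * (t + lam - y) ^ (-κ)))
      volume 0 (1 + t) ∧
    ∫ y in (0 : ℝ)..(1 + t), y ^ ((n : ℝ) - 1) * (K * y ^ e * (t + lam - y) ^ (-κ)) ≤
      K * (M * T) ^ (n - 1 + e) * L := by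
  have hR : 0 ≤ 1 + t := by linarith
  have heq : Set.EqOn (fun y : ℝ => y ^ ((n : ℝ) - 1) * (K * y ^ e * (t + lam - y) ^ (-κ)))
      (fun y : ℝ => K * y ^ ((n : ℝ) - 1 + e) * (t + lam - y) ^ (-κ)) (Set.uIoc 0 (1 + t)) := by
    intro y hy
    rw [Set.uIoc_of_le hR] at hy
    simp only
    rw [Real.rpow_add hy.1]
    ring
  have hI : IntervalIntegrable (fun y : ℝ => K * y ^ ((n : ℝ) - 1 + e) * (t + lam - y) ^ (-κ))
      volume 0 (1 + t) := by
    refine IntervalIntegrable.continuousOn_mul (intervalIntegrable_cone hlam ht) ?_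
    exact continuousOn_const.mul (ContinuousOn.rpow_const continuousOn_id fun y _ => Or.inr he)
  refine ⟨hI.congr heq.symm, ?_⟩
  have h2 : ∫ y in (0 : ℝ)..(1 + t), y ^ ((n : ℝ) - 1) * (K * y ^ e * (t + lam - y) ^ (-κ)) =
      ∫ y in (0 : ℝ)..(1 + t), K * y ^ ((n : ℝ) - 1 + e) * (t + lam - y) ^ (-κ) :=
    intervalIntegral.integral_congr_ae (Filter.Eventually.of_forall fun y hy => heq hy)
  rw [h2]
  refine (intervalIntegral.integral_mono_on (g := fun y => K * (M * T) ^ ((n : ℝ) - 1 + e) *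
    (t + lam - y) ^ (-κ)) hR hI ((intervalIntegrable_cone hlam ht).const_mul _) ?_).trans ?_
  · intro y hy
    have : 0 ≤ (t + lam - y) ^ (-κ) := Real.rpow_nonneg (by linarith [hy.2]) _
    gcongr
    · exact hy.1
    · exact hy.2.trans hRT
  · rw [intervalIntegral.integral_const_mul]
    gcongr

lemma integral_cone_eq {κ lam t : ℝ} :
    ∫ y in (0 : ℝ)..(1 + t), (t + lam - y) ^ (-κ) = ∫ u in (lam - 1)..(t + lam), u ^ (-κ) := by
  rw [intervalIntegral.integral_comp_sub_left (fun u : ℝ => u ^ (-κ)) (t + lam)]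
  congr 1 <;> ring

lemma integral_cone_le_of_lt_one {κ lam t M T : ℝ} (hκ : κ < 1) (hlam : 1 < lam) (ht : 0 ≤ t)
    (hM : 0 ≤ M) (hT : 0 < T) (h : t + lam ≤ M * T) :
    ∫ y in (0 : ℝ)..(1 + t), (t + lam - y) ^ (-κ) ≤
      M ^ (1 - κ) / (1 - κ) * (T ^ (-κ) * T) := by
  have hκ' : 0 < 1 - κ := by linarith
  have h1 : 0 ≤ (lam - 1) ^ (1 - κ) := Real.rpow_nonneg (by linarith) _
  have h2 : T ^ (-κ) * T = T ^ (1 - κ) := by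
    rw [show (1 - κ) = -κ + 1 by ring, Real.rpow_add_one hT.ne']
  rw [integral_cone_eq, integral_rpow (Or.inl (by linarith)), show -κ + 1 = 1 - κ by ring, h2,
    div_mul_eq_mul_div, ← Real.mul_rpow hM hT.le]
  have h3 : (t + lam) ^ (1 - κ) ≤ (M * T) ^ (1 - κ) :=
    Real.rpow_le_rpow (by linarith) h hκ'.le
  gcongr
  linarith

lemma integral_cone_le_log {lam t M T : ℝ} (hlam : 1 < lam) (ht : 0 ≤ t)
    (hM : 0 < M) (hT : 1 ≤ T) (h : t + lam ≤ M * T) :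
    ∫ y in (0 : ℝ)..(1 + t), (t + lam - y) ^ (-1 : ℝ) ≤
      (1 + |Real.log (M / (lam - 1))| / Real.log 2) * (T ^ (-1 : ℝ) * (T * Real.log (T + 1))) := by
  have hl : 0 < lam - 1 := by linarith
  have hT0 : 0 < T := by linarith
  have h2 : T ^ (-1 : ℝ) * (T * Real.log (T + 1)) = Real.log (T + 1) := by
    rw [Real.rpow_neg_one, ← mul_assoc, inv_mul_cancel₀ hT0.ne', one_mul]
  rw [integral_cone_eq, h2]
  simp only [Real.rpow_neg_one]
  rw [integral_inv_of_pos hl (by linarith)]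
  have hlog2 : 0 < Real.log 2 := Real.log_pos (by norm_num)
  have hlogT : Real.log 2 ≤ Real.log (T + 1) := Real.log_le_log (by norm_num) (by linarith)
  have h3 : Real.log ((t + lam) / (lam - 1)) ≤ Real.log T + Real.log (M / (lam - 1)) := by
    rw [← Real.log_mul hT0.ne' (by positivity)]
    refine Real.log_le_log (div_pos (by linarith) hl) ?_
    rw [← mul_div_assoc, mul_comm T M]
    gcongr
  have h4 : Real.log T ≤ Real.log (T + 1) := Real.log_le_log hT0 (by linarith)
  have h5 : |Real.log (M / (lam - 1))| ≤
      |Real.log (M / (lam - 1))| / Real.log 2 * Real.log (T + 1) := by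
    rw [div_mul_eq_mul_div, le_div_iff₀ hlog2]
    gcongr
  have h6 := le_abs_self (Real.log (M / (lam - 1)))
  linarith

/-- A singularity exponent `δ` admissible for the derivative term, together with the bound for
the corresponding light-cone integral. -/
lemma exists_cone_exponent {β c p p' lam : ℝ} (hp : 1 < p) (hp' : p' = p / (p - 1))
    (hlam : 1 < lam) (hβ : β ≤ c - 1 / p) :
    ∃ δ K : ℝ, 0 < δ ∧ 0 < K ∧ β + 1 ≤ c + δ ∧ ∀ T t : ℝ, 1 ≤ T → T / 2 ≤ t → t ≤ T →
      ∫ y in (0 : ℝ)..(1 + t), (t + lam - y) ^ (-(δ * p')) ≤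
        K * (T ^ (-(δ * p')) * if β < c - 1 / p then T else T * Real.log (T + 1)) := by
  have hp1 : 0 < p - 1 := by linarith
  have hp'0 : 0 < p' := by rw [hp']; exact div_pos (by linarith) hp1
  have hconj : 1 / p + 1 / p' = 1 := by
    rw [hp']
    have : p ≠ 0 := by linarith
    field_simp
    ring
  have hM : ∀ T t : ℝ, 1 ≤ T → t ≤ T → t + lam ≤ (1 + lam) * T := by
    intro T t h1 h2
    nlinarith
  by_cases hlt : β < c - 1 / p
  · simp only [hlt, if_true]
    have hκ : max (β + 1 - c) (1 / (2 * p')) * p' < 1 := by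
      rw [← lt_div_iff₀ hp'0]
      refine max_lt (by linarith) ?_
      gcongr
      linarith
    refine ⟨max (β + 1 - c) (1 / (2 * p')), (1 + lam) ^ (1 - max (β + 1 - c) (1 / (2 * p')) * p') /
      (1 - max (β + 1 - c) (1 / (2 * p')) * p'), lt_max_of_lt_right (by positivity),
      div_pos (Real.rpow_pos_of_pos (by linarith : 0 < 1 + lam) _) (sub_pos.mpr hκ),
      by linarith [le_max_left (β + 1 - c) (1 / (2 * p'))], fun T t hT h1 h2 => ?_⟩
    exact integral_cone_le_of_lt_one hκ hlam (by linarith) (by linarith) (by linarith)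
      (hM T t hT h2)
  · simp only [hlt, if_false]
    have hκ : 1 / p' * p' = 1 := by field_simp
    have hlog2 : 0 < Real.log 2 := Real.log_pos (by norm_num)
    refine ⟨1 / p', 1 + |Real.log ((1 + lam) / (lam - 1))| / Real.log 2, by positivity,
      by positivity, by linarith, fun T t hT h1 h2 => ?_⟩
    rw [hκ]
    exact integral_cone_le_log hlam (by linarith) (by linarith) hT (hM T t hT h2)

lemma Psi_pointwise_bounds {n : ℕ} {α γ ρ b lam t k K : ℝ} {x : EuclideanSpace ℝ (Fin n)}
    (hx : 0 < ‖x‖) (h : ‖x‖ < t + lam)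
    (hk : ∀ z : ℝ, 0 ≤ z → z < 1 → k ≤ hyperF α b γ z)
    (hK : ∀ z : ℝ, 0 ≤ z → z < 1 → hyperF α b γ z ≤ K) :
    k * (‖x‖ ^ ρ * (t + ‖x‖ + lam) ^ (-b)) ≤ Psi n α γ ρ b lam t x ∧
    Psi n α γ ρ b lam t x ≤ K * (‖x‖ ^ ρ * (t + ‖x‖ + lam) ^ (-b)) := by
  have h0 := hyper_arg_nonneg hx.le h
  have h1 := hyper_arg_lt_one hx.le h
  have hP : 0 ≤ ‖x‖ ^ ρ * (t + ‖x‖ + lam) ^ (-b) :=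
    mul_nonneg (Real.rpow_nonneg hx.le _) (Real.rpow_nonneg (by linarith) _)
  rw [Psi, mul_comm k, mul_comm K]
  exact ⟨mul_le_mul_of_nonneg_left (hk _ h0 h1) hP, mul_le_mul_of_nonneg_left (hK _ h0 h1) hP⟩

lemma Psi_le_cone {n : ℕ} {α γ ρ b lam t δ K : ℝ} {x : EuclideanSpace ℝ (Fin n)}
    (hx : 0 < ‖x‖) (h : ‖x‖ < t + lam)
    (hK : ∀ z : ℝ, 0 ≤ z → z < 1 → hyperF α b γ z ≤ K * (1 - z) ^ (-δ)) :
    Psi n α γ ρ b lam t x ≤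
      K * (‖x‖ ^ ρ * (t + ‖x‖ + lam) ^ (-b + δ) * (t + lam - ‖x‖) ^ (-δ)) := by
  have h0 := hyper_arg_nonneg hx.le h
  have h1 := hyper_arg_lt_one hx.le h
  have hτ : 0 < t + ‖x‖ + lam := by linarith
  have hP : 0 ≤ ‖x‖ ^ ρ * (t + ‖x‖ + lam) ^ (-b) :=
    mul_nonneg (Real.rpow_nonneg hx.le _) (Real.rpow_nonneg hτ.le _)
  refine (mul_le_mul_of_nonneg_left (hK _ h0 h1) hP).trans (le_of_eq ?_)
  rw [one_sub_hyper_arg hx.le h, Real.div_rpow (by linarith) hτ.le, Real.rpow_neg hτ.le δ,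
    Real.rpow_add hτ, div_inv_eq_mul]
  ring

/-- The weighted derivative term is controlled by a radial weight with a cone singularity. -/
lemma deriv_term_le {a k r τ q ρ b δ p p' X Y : ℝ} (ha : 0 ≤ a) (hk : 0 < k) (hr : 0 < r)
    (hτ : 0 < τ) (hq : 0 < q) (hp : 1 < p) (hp' : p' = p / (p - 1)) (hX0 : 0 ≤ X)
    (hX : X ≤ a * (r ^ ρ * τ ^ (-(b + 1) + δ) * q ^ (-δ))) (hY : k * (r ^ ρ * τ ^ (-b)) ≤ Y) :
    X ^ p' * Y ^ (-(p' / p)) ≤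
      a ^ p' * k ^ (-(p' / p)) * τ ^ (-b - p' + δ * p') * r ^ ρ * q ^ (-(δ * p')) := by
  have hp1 : 0 < p - 1 := by linarith
  have hp0 : 0 < p := by linarith
  have hp'0 : 0 < p' := by rw [hp']; exact div_pos hp0 hp1
  have hconj : p' + -(p' / p) = 1 := by
    rw [hp']; field_simp; ring
  have h1 := Real.rpow_le_rpow hX0 hX hp'0.le
  have h2 : Y ^ (-(p' / p)) ≤ (k * (r ^ ρ * τ ^ (-b))) ^ (-(p' / p)) :=
    Real.rpow_le_rpow_of_nonpos (by positivity) hY (by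
      have : 0 < p' / p := div_pos hp'0 hp0
      linarith)
  have hY0 : 0 ≤ Y := le_trans (by positivity) hY
  refine (mul_le_mul h1 h2 (Real.rpow_nonneg hY0 _) (by positivity)).trans (le_of_eq ?_)
  rw [Real.mul_rpow ha (by positivity), Real.mul_rpow (by positivity) (by positivity),
    Real.mul_rpow (by positivity) (by positivity), Real.mul_rpow hk.le (by positivity),
    Real.mul_rpow (by positivity) (by positivity), ← Real.rpow_mul hr.le, ← Real.rpow_mul hr.le,
    ← Real.rpow_mul hτ.le, ← Real.rpow_mul hτ.le, ← Real.rpow_mul hq.le]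
  have e1 : r ^ ρ = r ^ (ρ * p') * r ^ (ρ * -(p' / p)) := by
    rw [← Real.rpow_add hr, ← mul_add, hconj, mul_one]
  have e2 : τ ^ (-b - p' + δ * p') = τ ^ ((-(b + 1) + δ) * p') * τ ^ (-b * -(p' / p)) := by
    rw [← Real.rpow_add hτ]
    congr 1
    linear_combination b * hconj
  rw [e1, e2, neg_mul]
  ring

lemma scaled_rpow_le {I C a m e T S q : ℝ} (hI : 0 ≤ I) (hC : 0 ≤ C) (hT : 0 < T) (hS : 0 ≤ S)
    (hq : 0 ≤ q) (h : I ≤ C * T ^ a * S) (he : m + a * q = e) :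
    T ^ m * I ^ q ≤ C ^ q * (T ^ e * S ^ q) := by
  have h1 := Real.rpow_le_rpow hI h hq
  rw [Real.mul_rpow (by positivity) hS, Real.mul_rpow hC (by positivity),
    ← Real.rpow_mul hT.le] at h1
  refine (mul_le_mul_of_nonneg_left h1 (Real.rpow_nonneg hT.le m)).trans (le_of_eq ?_)
  rw [← he, Real.rpow_add hT]
  ring

set_option maxHeartbeats 1000000 in
/-- with `β₁ = β ≠ 0` and `β ≤ γ − α − 1/p`, there is a
constant `C` independent of `T` such that
`S(T;β,β) ≤ C T^((ρ+n)/p' − β − 2 + β/p) S₀(T)^(1/p')` for all `T ≥ 1`,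
where `S₀(T) = T` if `β < γ−α−1/p` and `S₀(T) = T ln(T+1)` if
`β = γ−α−1/p`. -/
theorem stmt11 (n : ℕ) (hn : 1 ≤ n) (A B : ℝ)
    (hB : -((n : ℝ) - 2) ^ 2 / 4 < B)
    (ρ : ℝ) (hρ : ρ = ((2 - (n : ℝ)) + Real.sqrt (((n : ℝ) - 2) ^ 2 + 4 * B)) / 2)
    (hA0 : 0 ≤ A) (hA1 : A < (n : ℝ) - 1 + 2 * ρ)
    (α γ : ℝ) (hα : α = ((n : ℝ) + A - 1 + 2 * ρ) / 2) (hγ : γ = (n : ℝ) - 1 + 2 * ρ)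
    (lam : ℝ) (hlam : 1 < lam)
    (p : ℝ) (hp : ((n : ℝ) + ρ) / ((n : ℝ) + ρ - 1) < p)
    (p' : ℝ) (hp' : p' = p / (p - 1))
    (β : ℝ) (hβ0 : β ≠ 0) (hβ : β ≤ γ - α - 1 / p) :
    ∃ C : ℝ, 0 < C ∧ ∀ T : ℝ, 1 ≤ T →
      Sfun n α γ ρ lam p p' β β T
        ≤ C * T ^ ((ρ + n) / p' - β - 2 + β / p) *
            (if β < γ - α - 1 / p then T else T * Real.log (T + 1)) ^ (1 / p') := by
  have hn1 : (1 : ℝ) ≤ n := by exact_mod_cast hn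
  have hΔ : 0 < Real.sqrt (((n : ℝ) - 2) ^ 2 + 4 * B) := Real.sqrt_pos.mpr (by linarith)
  have hα0 : 0 < α := by rw [hα]; linarith
  have hc : 0 < γ - α := by rw [hα, hγ]; linarith
  have hρn : 0 < (n : ℝ) + ρ - 1 := by linarith
  have hp1 : 1 < p := by
    refine lt_trans ?_ hp
    rw [lt_div_iff₀ hρn]
    linarith
  have hp0 : 0 < p := by linarith
  have hp10 : 0 < p - 1 := by linarith
  have hp'0 : 0 < p' := by rw [hp']; exact div_pos hp0 hp10
  have hp'n : p' < n + ρ := by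
    rw [div_lt_iff₀ hρn] at hp
    rw [hp', div_lt_iff₀ hp10]
    linarith
  have hconj : p' + -(p' / p) = 1 := by
    rw [hp']; field_simp; ring
  have hconj' : β / p = β - β * (1 / p') := by
    rw [hp']; field_simp; ring
  have hq0 : 0 ≤ 1 / p' := by positivity
  have hβc : β < γ - α := by
    have : 0 < 1 / p := by positivity
    linarith
  obtain ⟨k, hk0, hk⟩ := exists_le_hyperF β hα0 hc
  obtain ⟨k', hk'0, hk'⟩ := exists_le_hyperF (β + 1) hα0 hc
  obtain ⟨K, hK0, hK⟩ := exists_hyperF_le hα0 hc hβc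
  obtain ⟨δ, L, hδ, hL0, hδβ, hL⟩ := exists_cone_exponent hp1 hp' hlam hβ
  obtain ⟨K', hK'0, hK'⟩ := exists_hyperF_le_rpow hα0 hc hδ hδβ
  set M : ℝ := 3 + lam with hMdef
  have hM1 : 1 ≤ M := by linarith
  have hM0 : 0 < M := by linarith
  set V := volume.real (Metric.ball (0 : EuclideanSpace ℝ (Fin n)) 1) with hV
  have hnV : 0 ≤ (n : ℝ) * V := by positivity
  have hlog2 : 0 < Real.log 2 := Real.log_pos (by norm_num)
  have hlog2' : Real.log 2 ≤ 1 := by linarith [Real.log_two_lt_d9]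
  set K₁ := K * M ^ |(-β)| with hK₁
  have hK₁0 : 0 < K₁ := by positivity
  set a₃ := |β| * K' with ha₃
  have ha₃0 : 0 ≤ a₃ := by positivity
  set K₃ := a₃ ^ p' * k ^ (-(p' / p)) * M ^ |-β - p' + δ * p'| with hK₃
  have hK₃0 : 0 ≤ K₃ := by positivity
  set C₁ := n * V * (K₁ * (M ^ (n + ρ) / (n + ρ))) / Real.log 2 with hC₁
  have hC₁0 : 0 ≤ C₁ := by
    have : 0 < (n : ℝ) + ρ := by linarith
    positivity
  set C₂ := n * V * (K₁ * (M ^ (n + (ρ - p')) / (n + (ρ - p')))) / Real.log 2 with hC₂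
  have hC₂0 : 0 ≤ C₂ := by
    have : 0 < (n : ℝ) + (ρ - p') := by linarith
    positivity
  set C₃ := n * V * (K₃ * M ^ (n - 1 + ρ) * L) with hC₃
  have hC₃0 : 0 ≤ C₃ := by positivity
  refine ⟨C₁ ^ (1 / p') + C₂ ^ (1 / p') + C₃ ^ (1 / p') + 1, by positivity, fun T hT => ?_⟩
  have hT0 : 0 < T := by linarith
  clear_value M K₁ a₃ K₃ C₁ C₂ C₃
  set S : ℝ := if β < γ - α - 1 / p then T else T * Real.log (T + 1) with hS
  have hTS : T ≤ S / Real.log 2 := by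
    rw [le_div_iff₀ hlog2, hS]
    split_ifs
    · nlinarith
    · exact mul_le_mul_of_nonneg_left (Real.log_le_log (by norm_num) (by linarith)) hT0.le
  have hS0 : 0 ≤ S := by
    have := hT0.le.trans hTS
    rwa [le_div_iff₀ hlog2, zero_mul] at this
  have hτ : ∀ t r : ℝ, T / 2 ≤ t → t ≤ T → 0 < r → r < 1 + t →
      T / M ≤ t + r + lam ∧ t + r + lam ≤ M * T := by
    intro t r h1 h2 h3 h4
    constructor
    · have : T / M ≤ T / 2 := by gcongr; linarith
      linarith
    · nlinarith
  have hRT : ∀ t : ℝ, t ≤ T → 1 + t ≤ M * T := fun t h => by nlinarith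
  have hPsi : ∀ t, T / 2 ≤ t → t ≤ T → ∀ x : EuclideanSpace ℝ (Fin n), 0 < ‖x‖ → ‖x‖ < 1 + t →
      0 < Psi n α γ ρ β lam t x ∧ Psi n α γ ρ β lam t x ≤ K₁ * T ^ (-β) * ‖x‖ ^ ρ := by
    intro t h1 h2 x hx0 hx1
    have hb := Psi_pointwise_bounds (ρ := ρ) hx0 (by linarith : ‖x‖ < t + lam) hk hK
    have hτ' := hτ t ‖x‖ h1 h2 hx0 hx1
    have hτ0 : 0 < t + ‖x‖ + lam := by linarith
    refine ⟨lt_of_lt_of_le (by positivity) hb.1, hb.2.trans ?_⟩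
    have := rpow_le_of_comparable hM1 hT0 hτ'.1 hτ'.2 (-β)
    calc K * (‖x‖ ^ ρ * (t + ‖x‖ + lam) ^ (-β))
        ≤ K * (‖x‖ ^ ρ * (M ^ |(-β)| * T ^ (-β))) := by gcongr
      _ = K₁ * T ^ (-β) * ‖x‖ ^ ρ := by rw [hK₁]; ring
  have hmul : ∀ P : ℝ, 0 < P → P ^ p' * P ^ (-(p' / p)) = P := fun P hP => by
    rw [← Real.rpow_add hP, hconj, Real.rpow_one]
  have hKT : 0 ≤ K₁ * T ^ (-β) := by positivity
  have bound₁ := spacetime_integral_le hn hT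
    (f := fun t x => Psi n α γ ρ β lam t x ^ p' * Psi n α γ ρ β lam t x ^ (-(p' / p)))
    (g := fun _ y => K₁ * T ^ (-β) * y ^ ρ)
    (fun t h1 h2 x hx0 hx1 => by
      have h := hPsi t h1 h2 x hx0 hx1
      rw [hmul _ h.1]
      exact ⟨h.1.le, h.2⟩)
    (fun t h1 h2 => (integral_radial_power_le (by linarith) hKT (by linarith) hM0.le hT0.le
      (hRT t h2)).1)
    (fun t h1 h2 => (integral_radial_power_le (by linarith) hKT (by linarith) hM0.le hT0.le
      (hRT t h2)).2)
  have bound₂ := spacetime_integral_le hn hT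
    (f := fun t x => ‖x‖ ^ (-p') * Psi n α γ ρ β lam t x ^ p' *
      Psi n α γ ρ β lam t x ^ (-(p' / p)))
    (g := fun _ y => K₁ * T ^ (-β) * y ^ (ρ - p'))
    (fun t h1 h2 x hx0 hx1 => by
      have h := hPsi t h1 h2 x hx0 hx1
      have hx : 0 ≤ ‖x‖ ^ (-p') := by positivity
      rw [mul_assoc, hmul _ h.1]
      refine ⟨mul_nonneg hx h.1.le, (mul_le_mul_of_nonneg_left h.2 hx).trans (le_of_eq ?_)⟩
      rw [sub_eq_add_neg ρ, Real.rpow_add hx0]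
      ring)
    (fun t h1 h2 => (integral_radial_power_le (by linarith) hKT (by linarith) hM0.le hT0.le
      (hRT t h2)).1)
    (fun t h1 h2 => (integral_radial_power_le (by linarith) hKT (by linarith) hM0.le hT0.le
      (hRT t h2)).2)
  have hKT₃ : 0 ≤ K₃ * T ^ (-β - p' + δ * p') := by positivity
  have bound₃ := spacetime_integral_le hn hT
    (f := fun t x => |deriv (fun t' => Psi n α γ ρ β lam t' x) t| ^ p' *
      Psi n α γ ρ β lam t x ^ (-(p' / p)))
    (g := fun t y => K₃ * T ^ (-β - p' + δ * p') * y ^ ρ * (t + lam - y) ^ (-(δ * p')))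
    (fun t h1 h2 x hx0 hx1 => by
      have hxl : ‖x‖ < t + lam := by linarith
      have hτ' := hτ t ‖x‖ h1 h2 hx0 hx1
      have hτ0 : 0 < t + ‖x‖ + lam := by linarith
      have hq : 0 < t + lam - ‖x‖ := by linarith
      have hP := (hPsi t h1 h2 x hx0 hx1).1
      refine ⟨mul_nonneg (Real.rpow_nonneg (abs_nonneg _) _) (Real.rpow_nonneg hP.le _), ?_⟩
      have hD0 : 0 ≤ Psi n α γ ρ (β + 1) lam t x :=
        mul_nonneg (by positivity) (hk'0.le.trans
          (hk' _ (hyper_arg_nonneg hx0.le hxl) (hyper_arg_lt_one hx0.le hxl)))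
      have hX : |deriv (fun t' => Psi n α γ ρ β lam t' x) t| ≤
          a₃ * (‖x‖ ^ ρ * (t + ‖x‖ + lam) ^ (-(β + 1) + δ) * (t + lam - ‖x‖) ^ (-δ)) := by
        rw [(hasDerivAt_Psi n ρ β lam t x hα0 hc hxl).deriv, abs_mul, abs_neg,
          abs_of_nonneg hD0, ha₃, mul_assoc]
        exact mul_le_mul_of_nonneg_left (Psi_le_cone hx0 hxl hK') (abs_nonneg _)
      refine (deriv_term_le ha₃0 hk0 hx0 hτ0 hq hp1 hp' (abs_nonneg _) hX
        (Psi_pointwise_bounds hx0 hxl hk hK).1).trans ?_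
      have := rpow_le_of_comparable hM1 hT0 hτ'.1 hτ'.2 (-β - p' + δ * p')
      calc _ ≤ a₃ ^ p' * k ^ (-(p' / p)) * (M ^ |-β - p' + δ * p'| * T ^ (-β - p' + δ * p')) *
            ‖x‖ ^ ρ * (t + lam - ‖x‖) ^ (-(δ * p')) := by gcongr
        _ = _ := by rw [hK₃]; ring)
    (fun t h1 h2 => (integral_radial_cone_le (by linarith) hKT₃ hM0.le hT0.le (by linarith) hlam
      (hRT t h2) (hL T t hT h1 h2)).1)
    (fun t h1 h2 => (integral_radial_cone_le (by linarith) hKT₃ hM0.le hT0.le (by linarith) hlam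
      (hRT t h2) (hL T t hT h1 h2)).2)
  have fin₁ := scaled_rpow_le (m := -2) (q := 1 / p') (e := (ρ + n) / p' - β - 2 + β / p)
    (a := -β + (n + ρ)) (C := C₁) (S := S) bound₁.1 hC₁0 hT0 hS0 hq0
    (bound₁.2.trans (by
      calc _ = n * V * (K₁ * (M ^ (n + ρ) / (n + ρ))) * T ^ (-β + (n + ρ)) * T := by
            rw [Real.rpow_add hT0 (-β)]; ring
        _ ≤ n * V * (K₁ * (M ^ (n + ρ) / (n + ρ))) * T ^ (-β + (n + ρ)) *
            (S / Real.log 2) := by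
            refine mul_le_mul_of_nonneg_left hTS (mul_nonneg ?_ (by positivity))
            exact mul_nonneg hnV (mul_nonneg hK₁0.le (div_nonneg (by positivity) (by linarith)))
        _ = _ := by rw [hC₁]; ring))
    (by rw [hconj']; ring)
  have fin₂ := scaled_rpow_le (m := -1) (q := 1 / p') (e := (ρ + n) / p' - β - 2 + β / p)
    (a := -β + (n + (ρ - p'))) (C := C₂) (S := S) bound₂.1 hC₂0 hT0 hS0 hq0
    (bound₂.2.trans (by
      calc _ = n * V * (K₁ * (M ^ (n + (ρ - p')) / (n + (ρ - p')))) *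
            T ^ (-β + (n + (ρ - p'))) * T := by
            rw [Real.rpow_add hT0 (-β)]; ring
        _ ≤ n * V * (K₁ * (M ^ (n + (ρ - p')) / (n + (ρ - p')))) *
            T ^ (-β + (n + (ρ - p'))) * (S / Real.log 2) := by
            refine mul_le_mul_of_nonneg_left hTS (mul_nonneg ?_ (by positivity))
            exact mul_nonneg hnV (mul_nonneg hK₁0.le (div_nonneg (by positivity) (by linarith)))
        _ = _ := by rw [hC₂]; ring))
    (by rw [hconj']; field_simp; ring)
  have fin₃ := scaled_rpow_le (m := -1) (q := 1 / p') (e := (ρ + n) / p' - β - 2 + β / p)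
    (a := -β - p' + (n + ρ)) (C := C₃) (S := S) bound₃.1 hC₃0 hT0 hS0 hq0
    (bound₃.2.trans (le_of_eq (by
      have hexp : T ^ (-β - p' + (n + ρ)) =
          T ^ (-β - p' + δ * p') * T ^ ((n : ℝ) - 1 + ρ) * T ^ (-(δ * p')) * T := by
        rw [← Real.rpow_add hT0, ← Real.rpow_add hT0, ← Real.rpow_add_one hT0.ne']
        congr 1
        ring
      rw [hexp, Real.mul_rpow hM0.le hT0.le, hC₃]
      ring)))
    (by rw [hconj']; field_simp; ring)
  have hTS' : 0 ≤ T ^ ((ρ + n) / p' - β - 2 + β / p) * S ^ (1 / p') := by positivity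
  rw [Sfun, mul_assoc]
  linarith
end

section
/- Let C₁, C₂ > 0, a, b ≥ 0, κ < 1, and p > 1. Then there exists a constant C* = C*(C₁,C₂,p,κ) > 0 with the following property: for every ε ∈ (0,1] and every T > C* ε^{−((p−1)a+b)/(1−κ)}, there is no continuous function f : [1,T] → ℝ satisfying both f(y) ≥ C₁ ε^{a} and f(y) ≥ C₂ ε^{b} ∫₁^y (1 − η/y) f(η)^p η^{−κ} dη for all y ∈ [1,T]. Equivalently: any f : [1,∞) → ℝ satisfying both inequalities for all y ≥ 1 cannot remain finite; it blows up at some time T*(ε) ≤ C* ε^{−((p−1)a+b)/(1−κ)}. -/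
open MeasureTheory

/-- The integral of `(1 - η / y) f(η)^p η^(-κ)` over `[1, y]` is bounded below using only
the part over `[s, y]`, where `f ≥ m` and `η ∈ [R, 2R]`. -/
theorem kernel_integral_lower_bound {f : ℝ → ℝ} {κ p R m s y : ℝ} (hκ : κ < 1) (hp : 0 ≤ p)
    (hR : 1 ≤ R) (hm : 0 ≤ m) (hRs : R ≤ s) (hsy : s ≤ y) (hyR : y ≤ 2 * R)
    (hf : ContinuousOn f (Set.Icc 1 y)) (hpos : ∀ η ∈ Set.Icc 1 y, 0 < f η)
    (hmf : ∀ η ∈ Set.Icc s y, m ≤ f η) :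
    m ^ p * R ^ (-κ) * (y - s) ^ 2 / (8 * R) ≤
      ∫ η in (1 : ℝ)..y, (1 - η / y) * f η ^ p * η ^ (-κ) := by
  have hR0 : 0 < R := by linarith
  have hy0 : 0 < y := by linarith
  have hcont : ContinuousOn (fun η => (1 - η / y) * f η ^ p * η ^ (-κ)) (Set.Icc 1 y) := by
    refine ContinuousOn.mul (ContinuousOn.mul (by fun_prop) ?_) ?_
    · exact hf.rpow_const fun η hη => Or.inl (hpos η hη).ne'
    · exact continuousOn_id.rpow_const fun η hη =>
        Or.inl (lt_of_lt_of_le one_pos hη.1).ne'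
  have hint₁ : IntervalIntegrable (fun η => (1 - η / y) * f η ^ p * η ^ (-κ)) volume 1 s := by
    refine ContinuousOn.intervalIntegrable (hcont.mono ?_)
    rw [Set.uIcc_of_le (by linarith)]
    exact Set.Icc_subset_Icc le_rfl hsy
  have hint₂ : IntervalIntegrable (fun η => (1 - η / y) * f η ^ p * η ^ (-κ)) volume s y := by
    refine ContinuousOn.intervalIntegrable (hcont.mono ?_)
    rw [Set.uIcc_of_le hsy]
    exact Set.Icc_subset_Icc (by linarith) le_rfl
  rw [← intervalIntegral.integral_add_adjacent_intervals hint₁ hint₂]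
  have hnonneg : 0 ≤ ∫ η in (1 : ℝ)..s, (1 - η / y) * f η ^ p * η ^ (-κ) := by
    refine intervalIntegral.integral_nonneg (by linarith) fun η hη => ?_
    have h1 : 0 ≤ 1 - η / y := by
      rw [sub_nonneg, div_le_one hy0]
      exact hη.2.trans hsy
    have h2 := hpos η ⟨hη.1, hη.2.trans hsy⟩
    have h3 : 0 < η := lt_of_lt_of_le one_pos hη.1
    positivity
  have hlin : ∫ η in s..y, (y - η) * (m ^ p * R ^ (-κ) / (4 * R)) =
      m ^ p * R ^ (-κ) * (y - s) ^ 2 / (8 * R) := by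
    rw [intervalIntegral.integral_mul_const, intervalIntegral.integral_sub (by simp) (by simp),
      intervalIntegral.integral_const, integral_id, smul_eq_mul]
    field_simp
    ring
  have hmono : ∫ η in s..y, (y - η) * (m ^ p * R ^ (-κ) / (4 * R)) ≤
      ∫ η in s..y, (1 - η / y) * f η ^ p * η ^ (-κ) := by
    refine intervalIntegral.integral_mono_on hsy
      (Continuous.intervalIntegrable (by fun_prop) _ _) hint₂ fun η hη => ?_
    have hRη : R ≤ η := hRs.trans hη.1
    have hη0 : 0 < η := by linarith
    have hweight : (y - η) / (2 * R) ≤ 1 - η / y := by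
      rw [one_sub_div hy0.ne']
      exact div_le_div_of_nonneg_left (by linarith [hη.2]) hy0 hyR
    have hweight₀ : 0 ≤ (y - η) / (2 * R) := div_nonneg (by linarith [hη.2]) (by linarith)
    have hweight₁ : 0 ≤ 1 - η / y := hweight₀.trans hweight
    have hfη : 0 ≤ f η := hm.trans (hmf η hη)
    have hpow : m ^ p ≤ f η ^ p := Real.rpow_le_rpow hm (hmf η hη) hp
    have hkappa : R ^ (-κ) / 2 ≤ η ^ (-κ) := by
      have hratio : (1 : ℝ) / 2 ≤ (η / R) ^ (-κ) := by
        have h1 : 1 ≤ η / R := (one_le_div hR0).2 hRη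
        calc (1 : ℝ) / 2 ≤ (η / R)⁻¹ := by
              rw [inv_div, div_le_div_iff₀ two_pos hη0]
              linarith [hη.2]
          _ = (η / R) ^ (-1 : ℝ) := (Real.rpow_neg_one _).symm
          _ ≤ (η / R) ^ (-κ) := Real.rpow_le_rpow_of_exponent_le h1 (by linarith)
      rw [Real.div_rpow hη0.le hR0.le, le_div_iff₀ (by positivity)] at hratio
      linarith
    calc (y - η) * (m ^ p * R ^ (-κ) / (4 * R))
        = (y - η) / (2 * R) * m ^ p * (R ^ (-κ) / 2) := by ring
      _ ≤ (1 - η / y) * f η ^ p * η ^ (-κ) := by gcongr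
  linarith

/-- A function on `[R, 2R]` cannot gain quadratically at the superlinear rate `A m^p (y - s)²`
over each of its lower bounds `m` when `A M^(p-1) R²` is large: the bound would double on
geometrically shrinking steps. -/
theorem false_of_superlinear_gain {f : ℝ → ℝ} {p R A M q : ℝ} (hR : 0 < R)
    (hM : 0 < M) (hq₀ : 0 < q) (hq₁ : q < 1) (hq : q ^ 2 * 2 ^ (p - 1) = 1)
    (hMf : ∀ y ∈ Set.Icc R (2 * R), M ≤ f y)
    (hgain : ∀ m, 0 < m → ∀ s, R ≤ s → (∀ η ∈ Set.Icc s (2 * R), m ≤ f η) →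
      ∀ y ∈ Set.Icc s (2 * R), A * m ^ p * (y - s) ^ 2 ≤ f y)
    (hlarge : 2 ≤ A * M ^ (p - 1) * R ^ 2 * (1 - q) ^ 2) : False := by
  have hA : 0 ≤ A := by
    by_contra! hA
    have h1 : 0 ≤ M ^ (p - 1) * R ^ 2 * (1 - q) ^ 2 := by positivity
    nlinarith
  have hstep : ∀ j : ℕ, ∀ y ∈ Set.Icc (2 * R - R * q ^ j) (2 * R), 2 ^ j * M ≤ f y := by
    intro j
    induction j with
    | zero =>
      intro y hy
      simpa using hMf y ⟨by linarith [hy.1, pow_zero q], hy.2⟩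
    | succ j ih =>
      intro y hy
      have hqj : q ^ j ≤ 1 := pow_le_one₀ hq₀.le hq₁.le
      have hqj₀ : 0 < q ^ j := by positivity
      have hsy : R * (1 - q) * q ^ j ≤ y - (2 * R - R * q ^ j) := by
        have := hy.1
        rw [pow_succ] at this
        linarith
      have hd : 0 ≤ R * (1 - q) * q ^ j :=
        mul_nonneg (mul_nonneg hR.le (by linarith)) hqj₀.le
      have hm : 0 < (2 : ℝ) ^ j * M := by positivity
      have hgain' := hgain _ hm (2 * R - R * q ^ j) (by nlinarith) ih y ⟨by linarith, hy.2⟩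
      have hpow : ((2 : ℝ) ^ j * M) ^ p = (2 ^ (p - 1)) ^ j * M ^ (p - 1) * (2 ^ j * M) := by
        rw [← Real.rpow_mul_natCast two_pos.le, mul_comm (p - 1), Real.rpow_natCast_mul two_pos.le,
          ← Real.mul_rpow (by positivity) hM.le, ← Real.rpow_add_one hm.ne', sub_add_cancel]
      have hqpow : (q ^ 2) ^ j * (2 ^ (p - 1)) ^ j = 1 := by rw [← mul_pow, hq, one_pow]
      calc (2 : ℝ) ^ (j + 1) * M = 2 * (2 ^ j * M) := by ring
        _ ≤ A * M ^ (p - 1) * R ^ 2 * (1 - q) ^ 2 * (2 ^ j * M) := by gcongr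
        _ = A * M ^ (p - 1) * R ^ 2 * (1 - q) ^ 2 * (2 ^ j * M) *
            ((q ^ 2) ^ j * (2 ^ (p - 1)) ^ j) := by rw [hqpow, mul_one]
        _ = A * ((2 : ℝ) ^ j * M) ^ p * (R * (1 - q) * q ^ j) ^ 2 := by rw [hpow]; ring
        _ ≤ A * ((2 : ℝ) ^ j * M) ^ p * (y - (2 * R - R * q ^ j)) ^ 2 := by gcongr
        _ ≤ f y := hgain'
  obtain ⟨j, hj⟩ := pow_unbounded_of_one_lt (f (2 * R) / M) one_lt_two
  have := hstep j (2 * R) ⟨by nlinarith [pow_pos hq₀ j], le_rfl⟩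
  rw [div_lt_iff₀ hM] at hj
  linarith

/-- subcritical iterated-inequality blow-up lemma, `κ < 1`:
for `C₁, C₂ > 0`, `a, b ≥ 0`, `κ < 1`, `p > 1` there is `C* > 0` such that for
every `ε ∈ (0,1]` and `T > C* ε^(−((p−1)a+b)/(1−κ))` there is no continuous
`f : [1,T] → ℝ` with `f(y) ≥ C₁ ε^a` and
`f(y) ≥ C₂ ε^b ∫₁^y (1 − η/y) f(η)^p η^(−κ) dη` for all `y ∈ [1,T]`. -/
theorem stmt14 (C₁ C₂ : ℝ) (hC₁ : 0 < C₁) (hC₂ : 0 < C₂)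
    (a b : ℝ) (ha : 0 ≤ a) (hb : 0 ≤ b) (κ : ℝ) (hκ : κ < 1)
    (p : ℝ) (hp : 1 < p) :
    ∃ Cs : ℝ, 0 < Cs ∧ ∀ ε ∈ Set.Ioc (0 : ℝ) 1,
      ∀ T : ℝ, Cs * ε ^ (-(((p - 1) * a + b) / (1 - κ))) < T →
        ¬ ∃ f : ℝ → ℝ, ContinuousOn f (Set.Icc 1 T) ∧
          ∀ y ∈ Set.Icc (1 : ℝ) T,
            C₁ * ε ^ a ≤ f y ∧
            C₂ * ε ^ b * ∫ η in (1 : ℝ)..y, (1 - η / y) * f η ^ p * η ^ (-κ) ≤ f y := by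
  set q : ℝ := 2 ^ (-((p - 1) / 2)) with hq_def
  have hq₀ : 0 < q := by positivity
  have hq₁ : q < 1 := Real.rpow_lt_one_of_one_lt_of_neg one_lt_two (by linarith)
  have hq : q ^ 2 * 2 ^ (p - 1) = 1 := by
    rw [hq_def, ← Real.rpow_mul_natCast two_pos.le, ← Real.rpow_add two_pos,
      show -((p - 1) / 2) * ((2 : ℕ) : ℝ) + (p - 1) = 0 by push_cast; ring, Real.rpow_zero]
  have hq₂ : 0 < 1 - q := by linarith
  have hκ' : 0 < 1 - κ := by linarith
  set D : ℝ := 16 / (C₂ * C₁ ^ (p - 1) * (1 - q) ^ 2) with hD_def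
  have hD : 0 < D := by positivity
  refine ⟨2 * max 1 (D ^ (1 / (1 - κ))), by positivity, ?_⟩
  rintro ε ⟨hε₀, hε₁⟩ T hT ⟨f, hf, hfy⟩
  set e : ℝ := (p - 1) * a + b with he_def
  have he : 0 ≤ e := add_nonneg (mul_nonneg (by linarith) ha) hb
  obtain ⟨R, rfl⟩ : ∃ R, T = 2 * R := ⟨T / 2, by ring⟩
  have hRmax : max 1 (D ^ (1 / (1 - κ))) * ε ^ (-(e / (1 - κ))) < R := by linarith
  have hε_pow : 1 ≤ ε ^ (-(e / (1 - κ))) :=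
    Real.one_le_rpow_of_pos_of_le_one_of_nonpos hε₀ hε₁ (neg_nonpos.2 (by positivity))
  have hR : 1 ≤ R :=
    (one_le_mul_of_one_le_of_one_le (le_max_left _ _) hε_pow).trans hRmax.le
  have hR0 : 0 < R := by linarith
  have hRpow : D * ε ^ (-e) ≤ R ^ (1 - κ) := by
    calc D * ε ^ (-e) = (D ^ (1 / (1 - κ)) * ε ^ (-(e / (1 - κ)))) ^ (1 - κ) := by
          rw [Real.mul_rpow (by positivity) (by positivity), ← Real.rpow_mul hD.le,
            ← Real.rpow_mul hε₀.le, one_div_mul_cancel hκ'.ne', Real.rpow_one, neg_mul,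
            div_mul_cancel₀ _ hκ'.ne']
      _ ≤ R ^ (1 - κ) := by
          refine Real.rpow_le_rpow (by positivity) (le_trans ?_ hRmax.le) hκ'.le
          gcongr
          exact le_max_right _ _
  have hM : 0 < C₁ * ε ^ a := by positivity
  have hpos : ∀ y ∈ Set.Icc 1 (2 * R), 0 < f y := fun y hy => hM.trans_le (hfy y hy).1
  refine false_of_superlinear_gain (f := f) (p := p) (A := C₂ * ε ^ b * R ^ (-κ) / (8 * R))
    hR0 hM hq₀ hq₁ hq (fun y hy => (hfy y ⟨hR.trans hy.1, hy.2⟩).1) ?_ ?_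
  · intro m hm s hs hmf y hy
    have hsub : Set.Icc 1 y ⊆ Set.Icc 1 (2 * R) := Set.Icc_subset_Icc le_rfl hy.2
    have hlow := kernel_integral_lower_bound hκ (zero_le_one.trans hp.le) hR hm.le hs hy.1 hy.2
      (hf.mono hsub) (fun η hη => hpos η (hsub hη)) fun η hη => hmf η ⟨hη.1, hη.2.trans hy.2⟩
    calc C₂ * ε ^ b * R ^ (-κ) / (8 * R) * m ^ p * (y - s) ^ 2
        = C₂ * ε ^ b * (m ^ p * R ^ (-κ) * (y - s) ^ 2 / (8 * R)) := by ring
      _ ≤ C₂ * ε ^ b * ∫ η in (1 : ℝ)..y, (1 - η / y) * f η ^ p * η ^ (-κ) := by gcongr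
      _ ≤ f y := (hfy y ⟨(hR.trans hs).trans hy.1, hy.2⟩).2
  · have hεe : ε ^ b * (ε ^ a) ^ (p - 1) = ε ^ e := by
      rw [← Real.rpow_mul hε₀.le, ← Real.rpow_add hε₀, he_def]
      congr 1
      ring
    have hRκ : R ^ (-κ) * R = R ^ (1 - κ) := by
      rw [← Real.rpow_add_one hR0.ne', neg_add_eq_sub]
    calc (2 : ℝ) = C₂ * C₁ ^ (p - 1) * (1 - q) ^ 2 / 8 * ε ^ e * (D * ε ^ (-e)) := by
          rw [hD_def, Real.rpow_neg hε₀.le]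
          have := (Real.rpow_pos_of_pos hC₁ (p - 1)).ne'
          have := (Real.rpow_pos_of_pos hε₀ e).ne'
          have := hq₂.ne'
          field_simp
          norm_num
      _ ≤ C₂ * C₁ ^ (p - 1) * (1 - q) ^ 2 / 8 * ε ^ e * R ^ (1 - κ) := by gcongr
      _ = C₂ * ε ^ b * R ^ (-κ) / (8 * R) * (C₁ * ε ^ a) ^ (p - 1) * R ^ 2 * (1 - q) ^ 2 := by
          rw [Real.mul_rpow hC₁.le (by positivity), ← hεe, ← hRκ]
          field_simp
end

section
/- Let p > 1 and c > 0. Then there exists a constant C > 0 (depending only on p and c) such that for every ε ∈ (0,1] the following holds: if S ≥ 2 and I : [2,S] → ℝ is differentiable with I(2) ≥ 0 and satisfies I'(s) ≥ c ε^p and I'(s) ≥ c I(s)^p s^{1−p} for all s ∈ [2,S], then S ≤ C ε^{−p(p−1)}. -/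
/-- A function whose derivative on `[a, b]` is at least `m` grows at least at the linear rate `m`. -/
theorem mul_sub_le_sub_of_le_hasDerivWithinAt {f f' : ℝ → ℝ} {a b m : ℝ}
    (hf : ∀ s ∈ Set.Icc a b, HasDerivWithinAt f (f' s) (Set.Icc a b) s)
    (hm : ∀ s ∈ Set.Icc a b, m ≤ f' s) {s : ℝ} (hs : s ∈ Set.Icc a b) :
    m * (s - a) ≤ f s - f a := by
  have hd : ∀ t ∈ Set.Icc a b,
      HasDerivWithinAt (fun t => f t - m * t) (f' t - m) (Set.Icc a b) t := fun t ht => by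
    simpa only [id, mul_one] using! (hf t ht).sub ((hasDerivWithinAt_id t _).const_mul m)
  have hmono : MonotoneOn (fun t => f t - m * t) (Set.Icc a b) :=
    monotoneOn_of_hasDerivWithinAt_nonneg (convex_Icc a b)
      (fun t ht => (hd t ht).continuousWithinAt)
      (fun t ht => (hd t (interior_subset ht)).mono interior_subset)
      (fun t ht => sub_nonneg.2 (hm t (interior_subset ht)))
  have h := hmono ⟨le_rfl, hs.1.trans hs.2⟩ hs hs.1
  simp only at h
  linarith

/-- A positive solution of `f' ≥ k f ^ p`, `p > 1`, on `[a, b]` forces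
`(p - 1) k (b - a) ≤ f(a) ^ (1 - p)`. -/
theorem mul_sub_le_rpow_of_mul_rpow_le_hasDerivWithinAt {f f' : ℝ → ℝ} {a b k p : ℝ}
    (hp : 1 < p) (hab : a ≤ b)
    (hf : ∀ s ∈ Set.Icc a b, HasDerivWithinAt f (f' s) (Set.Icc a b) s)
    (hpos : ∀ s ∈ Set.Icc a b, 0 < f s)
    (hk : ∀ s ∈ Set.Icc a b, k * f s ^ p ≤ f' s) :
    (p - 1) * k * (b - a) ≤ f a ^ (1 - p) := by
  have hd : ∀ s ∈ Set.Icc a b, HasDerivWithinAt (fun s => -f s ^ (1 - p))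
      (-(f' s * (1 - p) * f s ^ (1 - p - 1))) (Set.Icc a b) s := fun s hs =>
    ((hf s hs).rpow_const (Or.inl (hpos s hs).ne')).neg
  have hm : ∀ s ∈ Set.Icc a b,
      (p - 1) * k ≤ -(f' s * (1 - p) * f s ^ (1 - p - 1)) := fun s hs => by
    have hcancel : f s ^ p * f s ^ (1 - p - 1) = 1 := by
      rw [← Real.rpow_add (hpos s hs)]
      simp
    have hq : 0 ≤ f s ^ (1 - p - 1) := (Real.rpow_pos_of_pos (hpos s hs) _).le
    calc (p - 1) * k = (p - 1) * (k * f s ^ p * f s ^ (1 - p - 1)) := by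
          rw [mul_assoc k, hcancel, mul_one]
      _ ≤ (p - 1) * (f' s * f s ^ (1 - p - 1)) := by
          have := sub_nonneg.2 hp.le
          have := hk s hs
          gcongr
      _ = _ := by ring
  have h := mul_sub_le_sub_of_le_hasDerivWithinAt hd hm (Set.right_mem_Icc.2 hab)
  have hb := Real.rpow_pos_of_pos (hpos b (Set.right_mem_Icc.2 hab)) (1 - p)
  linarith


/-- ODI system, critical Strauss case: for `p > 1`, `c > 0`
there is `C > 0` such that for every `ε ∈ (0,1]`, if `S ≥ 2` and
`I : [2,S] → ℝ` is differentiable with `I(2) ≥ 0`, `I'(s) ≥ c ε^p` and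
`I'(s) ≥ c I(s)^p s^(1−p)` on `[2,S]`, then `S ≤ C ε^(−p(p−1))`. -/
theorem stmt16 (p c : ℝ) (hp : 1 < p) (hc : 0 < c) :
    ∃ C : ℝ, 0 < C ∧ ∀ ε ∈ Set.Ioc (0 : ℝ) 1, ∀ S : ℝ, 2 ≤ S →
      ∀ I I' : ℝ → ℝ,
        (∀ s ∈ Set.Icc (2 : ℝ) S, HasDerivWithinAt I (I' s) (Set.Icc 2 S) s) →
        0 ≤ I 2 →
        (∀ s ∈ Set.Icc (2 : ℝ) S,
          c * ε ^ p ≤ I' s ∧ c * I s ^ p * s ^ (1 - p) ≤ I' s) →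
        S ≤ C * ε ^ (-(p * (p - 1))) := by
  set K : ℝ := (c / 4) ^ (1 - p) / ((p - 1) * c) with hK
  have hp' : 0 < p - 1 := sub_pos.2 hp
  have hKpos : 0 < K := by positivity
  refine ⟨8 + 2 * K, by positivity, ?_⟩
  rintro ε ⟨hε, hε1⟩ S hS I I' hI hI2 hODI
  have hE : 1 ≤ ε ^ (-(p * (p - 1))) :=
    Real.one_le_rpow_of_pos_of_le_one_of_nonpos hε hε1 (by nlinarith)
  rcases le_total S 8 with hS8 | hS8
  · nlinarith
  have hgrow : ∀ s ∈ Set.Icc 2 S, c * ε ^ p * (s - 2) ≤ I s := fun s hs => by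
    have := mul_sub_le_sub_of_le_hasDerivWithinAt hI (fun t ht => (hODI t ht).1) hs
    linarith
  have hεp : 0 < ε ^ p := Real.rpow_pos_of_pos hε p
  have hsub : Set.Icc (S / 2) S ⊆ Set.Icc 2 S := Set.Icc_subset_Icc_left (by linarith)
  have hpos : ∀ s ∈ Set.Icc (S / 2) S, 0 < I s := fun s hs => by
    have : 0 < s - 2 := by linarith [hs.1]
    exact lt_of_lt_of_le (by positivity) (hgrow s (hsub hs))
  have hS0 : 0 < S := by linarith
  have hblow := mul_sub_le_rpow_of_mul_rpow_le_hasDerivWithinAt (k := c * S ^ (1 - p)) hp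
    (by linarith : S / 2 ≤ S) (fun s hs => (hI s (hsub hs)).mono hsub) hpos
    (fun s hs => by
      refine le_trans ?_ (hODI s (hsub hs)).2
      have hs0 : 0 < s := by linarith [hs.1]
      have hle : S ^ (1 - p) ≤ s ^ (1 - p) :=
        Real.rpow_le_rpow_of_nonpos hs0 hs.2 (by linarith)
      have := Real.rpow_pos_of_pos (hpos s hs) p
      rw [mul_right_comm]
      gcongr)
  have hmid : S / 2 ∈ Set.Icc (S / 2) S := ⟨le_rfl, by linarith⟩
  have hlow : c / 4 * ε ^ p * S ≤ I (S / 2) := by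
    refine le_trans ?_ (hgrow _ (hsub hmid))
    have : 0 < c * ε ^ p := by positivity
    nlinarith
  have hup : I (S / 2) ^ (1 - p) ≤ (c / 4) ^ (1 - p) * ε ^ (-(p * (p - 1))) * S ^ (1 - p) := by
    refine (Real.rpow_le_rpow_of_nonpos (by positivity) hlow (by linarith)).trans_eq ?_
    rw [Real.mul_rpow (by positivity) hS0.le, Real.mul_rpow (by positivity) hεp.le,
      ← Real.rpow_mul hε.le]
    congr 3
    ring
  have hSp : 0 < S ^ (1 - p) := Real.rpow_pos_of_pos hS0 _
  have hlin : (p - 1) * c * (S / 2) ≤ (c / 4) ^ (1 - p) * ε ^ (-(p * (p - 1))) := by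
    refine le_of_mul_le_mul_right ?_ hSp
    linarith
  have hhalf : S / 2 ≤ K * ε ^ (-(p * (p - 1))) := by
    rw [hK, div_mul_eq_mul_div, le_div_iff₀ (by positivity)]
    linarith
  linarith
end

section
/- Let p > 1 and c > 0. Then there exists a constant C > 0 (depending only on p and c) such that for every ε ∈ (0,1] the following holds: if S ≥ 2 and I : [2,S] → ℝ is differentiable with I(2) ≥ 0 and satisfies I'(s) ≥ c ε^p and I'(s) ≥ c I(s)^p for all s ∈ [2,S], then S ≤ C ε^{−(p−1)}. -/
/-- A function on a compact interval with nonnegative one-sided-at-endpoints derivative is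
monotone. -/
theorem monotoneOn_Icc_of_hasDerivWithinAt_nonneg {a b : ℝ} {f f' : ℝ → ℝ}
    (hf : ∀ s ∈ Set.Icc a b, HasDerivWithinAt f (f' s) (Set.Icc a b) s)
    (hf' : ∀ s ∈ Set.Icc a b, 0 ≤ f' s) : MonotoneOn f (Set.Icc a b) :=
  monotoneOn_of_hasDerivWithinAt_nonneg (convex_Icc a b)
    (fun s hs => (hf s hs).continuousWithinAt)
    (fun s hs => (hf s (interior_subset hs)).mono interior_subset)
    (fun s hs => hf' s (interior_subset hs))

/-- If `f ≥ 0` satisfies `f' ≥ k (f + ε)^p` with `p > 1`, then the length of the interval of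
existence is controlled by `ε^(1-p)`. -/
theorem mul_sub_le_rpow_of_hasDerivWithinAt {a b p k ε : ℝ} {f f' : ℝ → ℝ} (hab : a ≤ b)
    (hp : 1 < p) (hε : 0 < ε)
    (hf : ∀ s ∈ Set.Icc a b, HasDerivWithinAt f (f' s) (Set.Icc a b) s)
    (hf0 : ∀ s ∈ Set.Icc a b, 0 ≤ f s)
    (hf' : ∀ s ∈ Set.Icc a b, k * (f s + ε) ^ p ≤ f' s) :
    (p - 1) * k * (b - a) ≤ ε ^ (1 - p) := by
  have hmono : MonotoneOn (fun s => -(f s + ε) ^ (1 - p) - (p - 1) * k * s) (Set.Icc a b) := by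
    refine monotoneOn_Icc_of_hasDerivWithinAt_nonneg
      (f' := fun s => -(f' s * (1 - p) * (f s + ε) ^ (1 - p - 1)) - (p - 1) * k * 1)
      (fun s hs => ?_) (fun s hs => ?_)
    · have hpos : 0 < f s + ε := by linarith [hf0 s hs]
      exact (((hf s hs).add_const ε).rpow_const (Or.inl hpos.ne')).neg.sub
        ((hasDerivWithinAt_id s _).const_mul _)
    · have hpos : 0 < f s + ε := by linarith [hf0 s hs]
      have hcancel : (f s + ε) ^ p * (f s + ε) ^ (1 - p - 1) = 1 := by
        rw [← Real.rpow_add hpos, show p + (1 - p - 1) = 0 by ring, Real.rpow_zero]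
      have hk : k ≤ f' s * (f s + ε) ^ (1 - p - 1) := by
        calc k = k * (f s + ε) ^ p * (f s + ε) ^ (1 - p - 1) := by rw [mul_assoc, hcancel, mul_one]
          _ ≤ _ := by gcongr; exact hf' s hs
      have := mul_le_mul_of_nonneg_left hk (sub_nonneg.2 hp.le)
      linarith
  have ha : a ∈ Set.Icc a b := Set.left_mem_Icc.2 hab
  have hb : b ∈ Set.Icc a b := Set.right_mem_Icc.2 hab
  have hle := hmono ha hb hab
  have hend : 0 ≤ (f b + ε) ^ (1 - p) := Real.rpow_nonneg (by linarith [hf0 b hb]) _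
  have hstart : (f a + ε) ^ (1 - p) ≤ ε ^ (1 - p) :=
    Real.rpow_le_rpow_of_nonpos hε (by linarith [hf0 a ha]) (by linarith)
  simp only at hle
  linarith

/-- ODI system, critical Fujita case: for `p > 1`, `c > 0`
there is `C > 0` such that for every `ε ∈ (0,1]`, if `S ≥ 2` and
`I : [2,S] → ℝ` is differentiable with `I(2) ≥ 0`, `I'(s) ≥ c ε^p` and
`I'(s) ≥ c I(s)^p` on `[2,S]`, then `S ≤ C ε^(−(p−1))`. -/
theorem stmt17 (p c : ℝ) (hp : 1 < p) (hc : 0 < c) :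
    ∃ C : ℝ, 0 < C ∧ ∀ ε ∈ Set.Ioc (0 : ℝ) 1, ∀ S : ℝ, 2 ≤ S →
      ∀ I I' : ℝ → ℝ,
        (∀ s ∈ Set.Icc (2 : ℝ) S, HasDerivWithinAt I (I' s) (Set.Icc 2 S) s) →
        0 ≤ I 2 →
        (∀ s ∈ Set.Icc (2 : ℝ) S, c * ε ^ p ≤ I' s ∧ c * I s ^ p ≤ I' s) →
        S ≤ C * ε ^ (-(p - 1)) := by
  have hk : 0 < (p - 1) * (c / 2 ^ p) := mul_pos (by linarith) (by positivity)
  refine ⟨2 + 1 / ((p - 1) * (c / 2 ^ p)), by positivity, ?_⟩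
  rintro ε ⟨hε, hε1⟩ S hS I I' hI hI2 hI'
  have hmono : MonotoneOn I (Set.Icc 2 S) :=
    monotoneOn_Icc_of_hasDerivWithinAt_nonneg hI
      fun s hs => le_trans (by positivity) (hI' s hs).1
  have hI0 : ∀ s ∈ Set.Icc 2 S, 0 ≤ I s := fun s hs =>
    hI2.trans (hmono (Set.left_mem_Icc.2 hS) hs hs.1)
  have hbound := mul_sub_le_rpow_of_hasDerivWithinAt (k := c / 2 ^ p) hS hp hε hI hI0 <| by
    intro s hs
    have h0 := hI0 s hs
    calc c / 2 ^ p * (I s + ε) ^ p = c * ((I s + ε) / 2) ^ p := by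
          rw [Real.div_rpow (by positivity) (by norm_num)]; ring
      _ ≤ I' s := by
        rcases le_total (I s) ε with h | h
        · refine le_trans ?_ (hI' s hs).1
          gcongr
          linarith
        · refine le_trans ?_ (hI' s hs).2
          gcongr
          linarith
  have hone : 1 ≤ ε ^ (1 - p) :=
    Real.one_le_rpow_of_pos_of_le_one_of_nonpos hε hε1 (by linarith)
  have hlen : S - 2 ≤ ε ^ (1 - p) / ((p - 1) * (c / 2 ^ p)) := by
    rw [le_div_iff₀ hk]
    linarith
  rw [neg_sub, add_mul, one_div_mul_eq_div]
  linarith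
end
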